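/- arXiv:1508.07451 — 2 statements merged into one kernel-verified Lean document; each statement's English description precedes it below -/
import Mathlib

section
/- Let (G, a, b) be an atomic chiral rotation pair of type (2^α, 2^β) with β > α ≥ 1. Then β ≥ 5 and exactly one of the following holds: either α = 3 and there exists ε ∈ {1, −1} such that b⁻¹ * a = a^3 * b^(1 + ε·2^(β−2)) and b * a⁻¹ = a^(−3) * b^(−1 + ε·2^(β−2)); or α ≥ 4, β = α + 1, and there exists ε ∈ {1, −1} such that b⁻¹ * a = a^(−1 + 2^(α−1)) * b^(−3 + ε·2^(α−1)) and b * a⁻¹ = a^(1 + 2^(α−1)) * b^(3 + ε·2^(α−1)). -/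
/-- A rotation pair of type `(p, q)`: the group is generated by `a` and `b`,
`a` has order `p`, `b` has order `q`, `p, q ≥ 2`, `(a*b)^2 = 1`, and the cyclic
subgroups generated by `a` and `b` intersect trivially. -/
def IsRotPair {G : Type*} [Group G] (a b : G) (p q : ℕ) : Prop :=
  Subgroup.closure ({a, b} : Set G) = ⊤ ∧ orderOf a = p ∧ orderOf b = q ∧
    2 ≤ p ∧ 2 ≤ q ∧ (a * b) ^ 2 = 1 ∧
    Subgroup.zpowers a ⊓ Subgroup.zpowers b = ⊥

/-- Tightness: every element is `a ^ i * b ^ j` for some integers `i, j`. -/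
def IsTight {G : Type*} [Group G] (a b : G) : Prop :=
  ∀ g : G, ∃ i j : ℤ, g = a ^ i * b ^ j

/-- Orientably regular: some group automorphism inverts both generators. -/
def IsOrientablyRegular {G : Type*} [Group G] (a b : G) : Prop :=
  ∃ φ : G ≃* G, φ a = a⁻¹ ∧ φ b = b⁻¹

/-- Chiral: no group automorphism inverts both generators. -/
def IsChiral {G : Type*} [Group G] (a b : G) : Prop :=
  ¬ IsOrientablyRegular a b

/-- `(G, a, b)` covers `(H, a', b')` if a homomorphism sends `a ↦ a'`, `b ↦ b'`. -/
def Covers {G H : Type*} [Group G] [Group H] (a b : G) (a' b' : H) : Prop :=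
  ∃ f : G →* H, f a = a' ∧ f b = b'

/-- An atomic chiral rotation pair of type `(p, q)`: a tight chiral rotation pair
covering no tight chiral rotation pair of type `(p', q)` with `p' < p` nor one of
type `(p, q')` with `q' < q`. -/
def IsAtomicPair {G : Type*} [Group G] (a b : G) (p q : ℕ) : Prop :=
  IsRotPair a b p q ∧ IsTight a b ∧ IsChiral a b ∧
  (∀ (H : Type) (instH : Group H) (_ : Finite H) (a' b' : H) (p' : ℕ), p' < p →
      @IsRotPair H instH a' b' p' q → @IsTight H instH a' b' → @IsChiral H instH a' b' →
      ¬ @Covers G H _ instH a b a' b') ∧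
  (∀ (H : Type) (instH : Group H) (_ : Finite H) (a' b' : H) (q' : ℕ), q' < q →
      @IsRotPair H instH a' b' p q' → @IsTight H instH a' b' → @IsChiral H instH a' b' →
      ¬ @Covers G H _ instH a b a' b')


/-- Working form of a tight rotation pair of type `(2^α, 2^β)`. -/
structure TP {G : Type*} [Group G] (a b : G) (α β : ℕ) : Prop where
  ab : a * b * (a * b) = 1
  ha : a ^ (2 ^ α) = 1
  hb : b ^ (2 ^ β) = 1
  uniq : ∀ i j : ℤ, a ^ i * b ^ j = 1 → (2 ^ α : ℤ) ∣ i ∧ (2 ^ β : ℤ) ∣ j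
  tight : ∀ g : G, ∃ i j : ℤ, g = a ^ i * b ^ j

section basics

variable {G : Type*} [Group G] {a b : G} {α β : ℕ}

theorem zpow_eq_one_of_dvd_two {x : G} {n : ℕ} (hx : x ^ (2 ^ n) = 1) {i : ℤ}
    (hi : (2 ^ n : ℤ) ∣ i) : x ^ i = 1 := by
  obtain ⟨k, rfl⟩ := hi
  have : x ^ ((2 : ℤ) ^ n) = 1 := by exact_mod_cast hx
  rw [zpow_mul, this, one_zpow]

theorem TP.swap (h : TP a b α β) : TP b a β α := by
  refine ⟨?_, h.hb, h.ha, ?_, ?_⟩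
  · have h1 := h.ab
    have : b * a * (b * a) = a⁻¹ * (a * b * (a * b)) * a := by group
    rw [this, h1]; group
  · intro i j hij
    have h2 : a ^ (-j) * b ^ (-i) = 1 := by
      have : a ^ (-j) * b ^ (-i) = (b ^ i * a ^ j)⁻¹ := by group
      rw [this, hij, inv_one]
    have := h.uniq _ _ h2
    simpa [and_comm] using this
  · intro g
    obtain ⟨i, j, hij⟩ := h.tight g⁻¹
    refine ⟨-j, -i, ?_⟩
    have : g = (g⁻¹)⁻¹ := by simp
    rw [this, hij]; group

theorem TP.eq_of_eq (h : TP a b α β) {i j k l : ℤ} (e : a ^ i * b ^ j = a ^ k * b ^ l) :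
    (2 ^ α : ℤ) ∣ i - k ∧ (2 ^ β : ℤ) ∣ j - l := by
  apply h.uniq
  have : a ^ (i - k) * b ^ (j - l) = a ^ (-k) * (a ^ i * b ^ j) * b ^ (-l) := by group
  rw [this, e]; group

theorem TP.b_dvd (h : TP a b α β) {j : ℤ} (e : b ^ j = 1) : (2 ^ β : ℤ) ∣ j :=
  (h.uniq 0 j (by simpa using e)).2

theorem TP.a_dvd (h : TP a b α β) {j : ℤ} (e : a ^ j = 1) : (2 ^ α : ℤ) ∣ j :=
  (h.uniq j 0 (by simpa using e)).1

theorem TP.z_ne (h : TP a b α (β + 1)) : b ^ (2 ^ β) ≠ 1 := by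
  intro e
  have := h.b_dvd (j := 2 ^ β) (by exact_mod_cast e)
  have h2 := Int.le_of_dvd (by positivity) this
  have : (0 : ℤ) < 2 ^ β := by positivity
  rw [pow_succ] at h2; linarith

theorem TP.z_sq (h : TP a b α (β + 1)) : b ^ (2 ^ β) * b ^ (2 ^ β) = 1 := by
  rw [← pow_add, ← two_mul, ← pow_succ', h.hb]

/-- Construction of the normal subgroups we need. -/
theorem TP.exN [Finite G] (h : TP a b α β) (w y : G) (m n : ℕ)
    (hw : w = a ^ m) (hy : y = b ^ n) (hc : Commute w y)
    (h1 : ∃ k l : ℤ, b * w = w ^ k * y ^ l * b) (h2 : ∃ k l : ℤ, a * y = w ^ k * y ^ l * a) :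
    ∃ N : Subgroup G, N.Normal ∧ ∀ g, g ∈ N ↔ ∃ k l : ℤ, g = w ^ k * y ^ l := by
  let N : Subgroup G :=
    { carrier := {g | ∃ k l : ℤ, g = w ^ k * y ^ l}
      one_mem' := ⟨0, 0, by simp⟩
      mul_mem' := by
        rintro _ _ ⟨k, l, rfl⟩ ⟨k', l', rfl⟩
        refine ⟨k + k', l + l', ?_⟩
        have := (hc.zpow_zpow k' l).eq
        rw [zpow_add, zpow_add, mul_assoc, ← mul_assoc (y ^ l), ← this]
        simp only [mul_assoc]
      inv_mem' := by
        rintro _ ⟨k, l, rfl⟩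
        refine ⟨-k, -l, ?_⟩
        rw [mul_inv_rev, zpow_neg, zpow_neg, ← zpow_neg, ← zpow_neg]
        exact ((hc.zpow_zpow (-k) (-l)).eq).symm }
  have hwN : w ∈ N := ⟨1, 0, by simp⟩
  have hyN : y ∈ N := ⟨0, 1, by simp⟩
  have key : ∀ c : G, c * w * c⁻¹ ∈ N → c * y * c⁻¹ ∈ N →
      c ∈ Subgroup.normalizer (N : Set G) := by
    intro c hcw hcy
    apply Subgroup.mem_normalizer_fintype
    rintro _ ⟨k, l, rfl⟩
    have : c * (w ^ k * y ^ l) * c⁻¹ = (c * w * c⁻¹) ^ k * (c * y * c⁻¹) ^ l := by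
      rw [conj_zpow, conj_zpow]; group
    rw [this]
    exact N.mul_mem (N.zpow_mem hcw k) (N.zpow_mem hcy l)
  have ha : a ∈ Subgroup.normalizer (N : Set G) := by
    apply key
    · have : a * w * a⁻¹ = w := by rw [hw]; group
      rw [this]; exact hwN
    · obtain ⟨k, l, e⟩ := h2
      rw [e, mul_inv_cancel_right]; exact ⟨k, l, rfl⟩
  have hb : b ∈ Subgroup.normalizer (N : Set G) := by
    apply key
    · obtain ⟨k, l, e⟩ := h1
      rw [e, mul_inv_cancel_right]; exact ⟨k, l, rfl⟩
    · have : b * y * b⁻¹ = y := by rw [hy]; group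
      rw [this]; exact hyN
  refine ⟨N, ?_, fun g => Iff.rfl⟩
  rw [← Subgroup.normalizer_eq_top_iff, Subgroup.eq_top_iff']
  intro g
  obtain ⟨i, j, rfl⟩ := h.tight g
  exact Subgroup.mul_mem _ (Subgroup.zpow_mem _ ha i) (Subgroup.zpow_mem _ hb j)

theorem TP.quot (h : TP a b α β) {α' β' : ℕ} (hα : α' ≤ α) (hβ : β' ≤ β)
    (N : Subgroup G) [N.Normal]
    (hN : ∀ g, g ∈ N ↔ ∃ k l : ℤ, g = (a ^ (2 ^ α')) ^ k * (b ^ (2 ^ β')) ^ l) :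
    TP (a : G ⧸ N) (b : G ⧸ N) α' β' := by
  refine ⟨?_, ?_, ?_, ?_, ?_⟩
  · rw [← QuotientGroup.mk_mul, ← QuotientGroup.mk_mul, h.ab, QuotientGroup.mk_one]
  · rw [← QuotientGroup.mk_pow, QuotientGroup.eq_one_iff, hN]
    exact ⟨1, 0, by simp⟩
  · rw [← QuotientGroup.mk_pow, QuotientGroup.eq_one_iff, hN]
    exact ⟨0, 1, by simp⟩
  · intro i j e
    rw [← QuotientGroup.mk_zpow, ← QuotientGroup.mk_zpow, ← QuotientGroup.mk_mul,
      QuotientGroup.eq_one_iff, hN] at e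
    obtain ⟨k, l, e⟩ := e
    have e2 : a ^ i * b ^ j = a ^ (2 ^ α' * k) * b ^ (2 ^ β' * l) := by
      rw [e, zpow_mul, zpow_mul]; norm_cast
    obtain ⟨d1, d2⟩ := h.eq_of_eq e2
    have d3 : (2 ^ α' : ℤ) ∣ 2 ^ α := pow_dvd_pow _ hα
    have d4 : (2 ^ β' : ℤ) ∣ 2 ^ β := pow_dvd_pow _ hβ
    exact ⟨(dvd_sub_left (Dvd.intro _ rfl)).1 (d3.trans d1),
      (dvd_sub_left (Dvd.intro _ rfl)).1 (d4.trans d2)⟩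
  · intro g
    obtain ⟨g, rfl⟩ := QuotientGroup.mk_surjective g
    obtain ⟨i, j, e⟩ := h.tight g
    exact ⟨i, j, by rw [e]; rfl⟩

theorem TP.isPGroup [Finite G] (h : TP a b α β) : IsPGroup 2 G := by
  have h1 : Subgroup.IsComplement' (Subgroup.zpowers a) (Subgroup.zpowers b) := by
    apply Subgroup.isComplement'_of_disjoint_and_mul_eq_univ
    · rw [Subgroup.disjoint_def]
      rintro x ⟨i, rfl⟩ ⟨j, e⟩
      have e : b ^ j = a ^ i := e
      have : a ^ i * b ^ (-j) = 1 := by rw [← e]; group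
      exact zpow_eq_one_of_dvd_two h.ha (h.uniq _ _ this).1
    · rw [Set.eq_univ_iff_forall]
      intro g
      obtain ⟨i, j, rfl⟩ := h.tight g
      exact Set.mul_mem_mul ⟨i, rfl⟩ ⟨j, rfl⟩
  have h2 := h1.card_mul_card
  rw [Nat.card_zpowers, Nat.card_zpowers] at h2
  obtain ⟨i, _, hi⟩ := (Nat.dvd_prime_pow Nat.prime_two).1 (orderOf_dvd_of_pow_eq_one h.ha)
  obtain ⟨j, _, hj⟩ := (Nat.dvd_prime_pow Nat.prime_two).1 (orderOf_dvd_of_pow_eq_one h.hb)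
  rw [hi, hj, ← pow_add] at h2
  exact IsPGroup.of_card h2.symm

theorem exists_mul_pow_two (β : ℕ) : ∀ m : ℤ, ¬ (2 ^ (β + 1) : ℤ) ∣ m →
    ∃ n : ℤ, (2 ^ β : ℤ) ∣ m * n ∧ ¬ (2 ^ (β + 1) : ℤ) ∣ m * n := by
  induction β with
  | zero => intro m hm; exact ⟨1, by simp, by simpa using hm⟩
  | succ β ih =>
    intro m hm
    by_cases hd : (2 ^ (β + 1) : ℤ) ∣ m
    · exact ⟨1, by simpa using hd, by simpa using hm⟩
    · obtain ⟨n, h1, h2⟩ := ih m hd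
      refine ⟨n * 2, ?_, ?_⟩
      · rw [← mul_assoc, pow_succ]; exact mul_dvd_mul_right h1 2
      · rw [← mul_assoc, pow_succ]
        intro h3
        exact h2 ((mul_dvd_mul_iff_right (by norm_num)).1 h3)

theorem TP.parity [Finite G] (h : TP a b (α + 1) β) {y g f : ℤ}
    (e : a * b ^ y * a⁻¹ = b ^ g * a ^ f) : Even f := by
  have : Fact (Nat.Prime 2) := ⟨Nat.prime_two⟩
  have : Group.IsNilpotent G := h.isPGroup.isNilpotent
  have hnc : NormalizerCondition G := Group.normalizerCondition_of_isNilpotent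
  have hne : Subgroup.zpowers b ≠ ⊤ := by
    intro ht
    have : a ∈ Subgroup.zpowers b := by rw [ht]; trivial
    obtain ⟨j, e⟩ := this
    have e : b ^ j = a := e
    have : a ^ (1 : ℤ) * b ^ (-j) = 1 := by rw [← e]; group
    have := (h.uniq _ _ this).1
    have h3 : (2 : ℤ) ∣ 2 ^ (α + 1) := dvd_pow_self _ (by omega)
    have := h3.trans this
    omega
  obtain ht | ⟨M, hM, hle⟩ := eq_top_or_exists_le_coatom (Subgroup.zpowers b)
  · exact absurd ht hne
  have := Subgroup.NormalizerCondition.normal_of_coatom M hnc hM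
  have hbM : b ∈ M := hle (Subgroup.mem_zpowers b)
  have haM : a ∉ M := by
    intro haM
    apply hM.1
    rw [Subgroup.eq_top_iff']
    intro g
    obtain ⟨i, j, rfl⟩ := h.tight g
    exact M.mul_mem (M.zpow_mem haM i) (M.zpow_mem hbM j)
  have h1 : a ^ f ∈ M := by
    have : a ^ f = (b ^ g)⁻¹ * (a * b ^ y * a⁻¹) := by rw [e]; group
    rw [this]
    exact M.mul_mem (M.inv_mem (M.zpow_mem hbM g)) (Subgroup.Normal.conj_mem ‹_› _ (M.zpow_mem hbM y) a)
  by_contra hodd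
  rw [Int.not_even_iff_odd] at hodd
  apply haM
  have hcop : IsCoprime f (2 ^ (α + 1) : ℤ) := by
    apply IsCoprime.pow_right
    obtain ⟨r, rfl⟩ := hodd
    exact ⟨1, -r, by ring⟩
  obtain ⟨u, v, huv⟩ := hcop
  have : a = (a ^ f) ^ u * (a ^ (2 ^ (α + 1) : ℤ)) ^ v := by
    rw [← zpow_mul, ← zpow_mul, ← zpow_add, mul_comm f u, mul_comm _ v, huv, zpow_one]
  have h4 : a ^ (2 ^ (α + 1) : ℤ) = 1 := by exact_mod_cast h.ha
  rw [this, h4, one_zpow, mul_one]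
  exact M.zpow_mem h1 u

theorem TP.core [Finite G] (h : TP a b α (β + 1)) (hle : α ≤ β + 1) :
    Commute a (b ^ (2 ^ β)) := by
  obtain _ | α := α
  · have : a = 1 := by simpa using h.ha
    rw [this]; exact Commute.one_left _
  have h0 : ∀ y : ℕ, ∃ g f : ℤ, a * b ^ (y : ℤ) * a⁻¹ = b ^ g * a ^ f :=
    fun y => h.swap.tight _
  choose g f hgf using h0
  have hf : ∀ y, Even (f y) := fun y => h.parity (hgf y)
  let F : Fin (2 ^ (β + 1)) → ZMod (2 ^ α) := fun y => ((f y / 2 : ℤ) : ZMod (2 ^ α))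
  have : NeZero (2 ^ α) := ⟨by positivity⟩
  obtain ⟨y, y', hne, hF⟩ : ∃ y y', y ≠ y' ∧ F y = F y' := by
    apply Fintype.exists_ne_map_eq_of_card_lt
    rw [ZMod.card, Fintype.card_fin]
    exact Nat.pow_lt_pow_right (by norm_num) (by omega)
  have hd : ((2 ^ (α + 1) : ℕ) : ℤ) ∣ f y - f y' := by
    have := (ZMod.intCast_eq_intCast_iff_dvd_sub _ _ _).1 hF.symm
    obtain ⟨k, hk⟩ := this
    obtain ⟨u, hu⟩ := hf y
    obtain ⟨v, hv⟩ := hf y'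
    refine ⟨k, ?_⟩
    rw [hu, hv] at hk ⊢
    push_cast at hk ⊢
    rw [pow_succ]
    have e1 : (u + u) / 2 = u := by omega
    have e2 : (v + v) / 2 = v := by omega
    rw [e1, e2] at hk
    linear_combination 2 * hk
  have haf : a ^ f y = a ^ f y' := by
    have : a ^ (f y - f y') = 1 := zpow_eq_one_of_dvd_two h.ha (by exact_mod_cast hd)
    rw [zpow_sub] at this
    exact mul_inv_eq_one.1 this
  set m : ℤ := (y : ℤ) - (y' : ℤ) with hm
  have hmd : ¬ (2 ^ (β + 1) : ℤ) ∣ m := by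
    intro hdv
    apply hne
    have h1 := y.2
    have h2 := y'.2
    have h1' : ((y : ℕ) : ℤ) < 2 ^ (β + 1) := by exact_mod_cast h1
    have h2' : ((y' : ℕ) : ℤ) < 2 ^ (β + 1) := by exact_mod_cast h2
    have := Int.eq_zero_of_abs_lt_dvd hdv (by rw [abs_lt]; constructor <;> omega)
    ext; omega
  obtain ⟨n, hn1, hn2⟩ := exists_mul_pow_two β m hmd
  have hconj : a * b ^ m * a⁻¹ = b ^ (g y - g y') := by
    have : a * b ^ m * a⁻¹ = (a * b ^ ((y : ℕ) : ℤ) * a⁻¹) * (a * b ^ ((y' : ℕ) : ℤ) * a⁻¹)⁻¹ := by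
      rw [hm]; group
    rw [this, hgf, hgf, haf]; group
  have hconj2 : a * b ^ (m * n) * a⁻¹ = b ^ ((g y - g y') * n) := by
    rw [zpow_mul, zpow_mul, ← hconj, conj_zpow]
  have hz2 := h.z_sq
  -- odd multiples
  have hval : ∀ M : ℤ, (2 ^ β : ℤ) ∣ M → ¬ (2 ^ (β + 1) : ℤ) ∣ M → b ^ M = b ^ (2 ^ β) := by
    rintro _ ⟨k, rfl⟩ hk
    have hko : Odd k := by
      rw [← Int.not_even_iff_odd]
      rintro ⟨r, rfl⟩
      exact hk ⟨r, by ring⟩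
    obtain ⟨r, rfl⟩ := hko
    have e1 : b ^ (2 ^ β * (2 * r + 1) : ℤ) = (b ^ ((2 : ℤ) ^ (β + 1))) ^ r * b ^ ((2 : ℤ) ^ β) := by
      rw [← zpow_mul, ← zpow_add]; congr 1; ring
    have e2 : b ^ ((2 : ℤ) ^ (β + 1)) = 1 := by exact_mod_cast h.hb
    rw [e1, e2, one_zpow, one_mul]; norm_cast
  rw [hval _ hn1 hn2] at hconj2
  set M := (g y - g y') * n
  have hM1 : (2 ^ β : ℤ) ∣ M := by
    have : b ^ (M + M) = 1 := by
      rw [zpow_add, ← hconj2]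
      have : a * b ^ 2 ^ β * a⁻¹ * (a * b ^ 2 ^ β * a⁻¹) = a * (b ^ 2 ^ β * b ^ 2 ^ β) * a⁻¹ := by group
      rw [this, hz2]; group
    have := h.b_dvd this
    rw [pow_succ, ← mul_two] at this
    exact (mul_dvd_mul_iff_right (by norm_num)).1 this
  have hM2 : ¬ (2 ^ (β + 1) : ℤ) ∣ M := by
    intro hd
    rw [zpow_eq_one_of_dvd_two h.hb hd] at hconj2
    apply h.z_ne
    have : b ^ 2 ^ β = a⁻¹ * (a * b ^ 2 ^ β * a⁻¹) * a := by group
    rw [this, hconj2]; group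
  rw [hval M hM1 hM2] at hconj2
  exact mul_inv_eq_iff_eq_mul.1 hconj2

end basics

section middle

universe u

theorem mk_eq_imp {G : Type*} [Group G] {N : Subgroup G} [N.Normal] {x y : G}
    (e : (x : G ⧸ N) = (y : G ⧸ N)) : ∃ n ∈ N, x = y * n := by
  have := QuotientGroup.eq.1 e.symm
  exact ⟨_, this, by group⟩

theorem zpow_of_sq {G : Type*} [Group G] {x : G} (hx : x * x = 1) (k : ℤ) :
    x ^ k = 1 ∨ x ^ k = x := by
  have hx2 : x ^ (2 : ℤ) = 1 := by rw [zpow_ofNat, pow_two, hx]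
  rcases Int.even_or_odd' k with ⟨r, rfl | rfl⟩
  · left; rw [zpow_mul, hx2, one_zpow]
  · right; rw [zpow_add, zpow_mul, hx2, one_zpow, zpow_one, one_mul]

theorem TP.quotZ {G : Type*} [Group G] [Finite G] {a b : G} {α β : ℕ}
    (h : TP a b α (β + 1)) (hle : α ≤ β + 1) :
    ∃ N : Subgroup G, ∃ _ : N.Normal, (∀ g, g ∈ N → g = 1 ∨ g = b ^ (2 ^ β)) ∧
      TP (a : G ⧸ N) (b : G ⧸ N) α β := by
  obtain ⟨N, hN, hm⟩ := h.exN (a ^ (2 ^ α)) (b ^ (2 ^ β)) _ _ rfl rfl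
    (by rw [h.ha]; exact Commute.one_left _)
    ⟨0, 0, by rw [h.ha]; simp⟩ ⟨0, 1, by simpa using (h.core hle).eq⟩
  refine ⟨N, hN, ?_, h.quot le_rfl (Nat.le_succ _) N hm⟩
  intro g hg
  obtain ⟨k, l, rfl⟩ := (hm g).1 hg
  rw [h.ha, one_zpow, one_mul]
  exact zpow_of_sq h.z_sq l

theorem TP.quotW {G : Type*} [Group G] [Finite G] {a b : G} {α β : ℕ}
    (h : TP a b (α + 1) β) (hc : Commute b (a ^ (2 ^ α))) :
    ∃ N : Subgroup G, ∃ _ : N.Normal, (∀ g, g ∈ N → g = 1 ∨ g = a ^ (2 ^ α)) ∧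
      TP (a : G ⧸ N) (b : G ⧸ N) α β := by
  obtain ⟨N, hN, hm⟩ := h.exN (a ^ (2 ^ α)) (b ^ (2 ^ β)) _ _ rfl rfl
    (by rw [h.hb]; exact Commute.one_right _)
    ⟨1, 0, by simpa using hc.eq⟩ ⟨0, 0, by rw [h.hb]; simp⟩
  refine ⟨N, hN, ?_, h.quot (Nat.le_succ _) le_rfl N hm⟩
  intro g hg
  obtain ⟨k, l, rfl⟩ := (hm g).1 hg
  rw [h.hb, one_zpow, mul_one]
  exact zpow_of_sq h.swap.z_sq k

theorem lemA : ∀ (β : ℕ) {G : Type u} [Group G] [Finite G] {a b : G} {α : ℕ},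
    TP a b (α + 1) (β + 1) → 1 ≤ α → α ≤ β →
    Commute b (a ^ (2 ^ α)) ∨
      b * a ^ (2 ^ α) * b⁻¹ = a ^ (2 ^ α) * b ^ (2 ^ β) := by
  intro β
  induction β with
  | zero => intro G _ _ a b α h h1 h2; omega
  | succ β ih =>
    intro G _ _ a b α h h1 h2
    by_cases hαβ : α = β + 1
    · left
      exact h.swap.core (by omega)
    obtain ⟨N, hN, hm, hq⟩ := h.quotZ (by omega)
    have hz2 := h.z_sq
    have hz := h.z_ne
    have hw2 := h.swap.z_sq
    have hda := hq.core (by omega)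
    obtain ⟨n, hn, hda⟩ := mk_eq_imp (N := N) (x := a * b ^ (2 ^ β)) (y := b ^ (2 ^ β) * a) hda.eq
    set z := b ^ (2 ^ (β + 1)) with hzdef
    set d := b ^ (2 ^ β) with hd
    set w := a ^ (2 ^ α) with hw
    have hdd : d * d = z := by rw [hd, ← pow_add, ← two_mul, ← pow_succ', hzdef]
    have hcz : Commute a z := h.core (by omega)
    rcases ih hq h1 (by omega) with hc | hc
    · have hc : ((b * w : G) : G ⧸ N) = ((w * b : G) : G ⧸ N) := hc.eq
      have : ((b * w * b⁻¹ : G) : G ⧸ N) = (w : G ⧸ N) := by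
        rw [QuotientGroup.mk_mul, hc, ← QuotientGroup.mk_mul, mul_inv_cancel_right]
      obtain ⟨n, hn, e⟩ := mk_eq_imp this
      rcases hm n hn with rfl | rfl
      · left; rw [mul_one] at e; exact mul_inv_eq_iff_eq_mul.1 e
      · right; exact e
    · exfalso
      have hc : ((b * w * b⁻¹ : G) : G ⧸ N) = ((w * d : G) : G ⧸ N) := hc
      obtain ⟨n', hn', e⟩ := mk_eq_imp hc
      -- a ^ 2 commutes with d
      have hcd : Commute (a * a) d := by
        have hd' : SemiconjBy a d (d * n) := by
          have hcn : Commute a n := by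
            rcases hm n hn with rfl | rfl
            · exact Commute.one_right _
            · exact hcz
          show a * d = d * n * a
          rw [hda, mul_assoc, mul_assoc, hcn.eq]
        rcases hm n hn with rfl | rfl
        · rw [mul_one] at hd'; exact SemiconjBy.mul_left hd' hd'
        · have h3 : SemiconjBy a (d * z) (d * z * z) := hd'.mul_right hcz
          rw [mul_assoc, hz2, mul_one] at h3
          exact SemiconjBy.mul_left h3 hd'
      have hcwd : Commute w d := by
        obtain ⟨r, rfl⟩ : ∃ r, α = r + 1 := ⟨α - 1, by omega⟩
        have : w = (a * a) ^ (2 ^ r) := by rw [hw, ← pow_two, ← pow_mul, ← pow_succ']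
        rw [this]; exact hcd.pow_left _
      have hcwz : Commute w z := hcz.pow_left _
      have hcdz : Commute d z := (Commute.refl b).pow_pow _ _
      have hsq : (b * w * b⁻¹) * (b * w * b⁻¹) = 1 := by
        have : (b * w * b⁻¹) * (b * w * b⁻¹) = b * (w * w) * b⁻¹ := by group
        rw [this, hw2]; group
      have key : ∀ n'' : G, n'' * n'' = 1 → Commute w n'' → Commute d n'' →
          (w * d * n'') * (w * d * n'') = z := by
        intro n'' h1 h2 h3
        have h4 : Commute (w * d) n'' := h2.mul_left h3
        rw [mul_assoc, ← mul_assoc n'', ← h4.eq, mul_assoc _ n'', h1, mul_one, mul_assoc,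
          ← mul_assoc d, ← hcwd.eq, mul_assoc w d d, ← mul_assoc w w, hw2, one_mul, hdd]
      apply hz
      rw [← hsq, e]
      symm
      rcases hm n' hn' with rfl | rfl
      · exact key 1 (by simp) (Commute.one_right _) (Commute.one_right _)
      · exact key z hz2 hcwz hcdz

/-- The situation arising for atomic pairs; the type is `(2^(α+1), 2^(β+1))`. -/
structure Good {G : Type*} [Group G] (a b : G) (α β : ℕ) : Prop where
  tp : TP a b (α + 1) (β + 1)
  one : 1 ≤ α
  le : α + 1 ≤ β
  bw : SemiconjBy b (a ^ (2 ^ α)) (a ^ (2 ^ α) * b ^ (2 ^ β))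

theorem Good.bbw {G : Type*} [Group G] [Finite G] {a b : G} {α β : ℕ} (h : Good a b α β) :
    Commute (b * b) (a ^ (2 ^ α)) := by
  have h1 : SemiconjBy b (a ^ (2 ^ α) * b ^ (2 ^ β)) (a ^ (2 ^ α) * b ^ (2 ^ β) * b ^ (2 ^ β)) :=
    h.bw.mul_right ((Commute.refl b).pow_right _)
  rw [mul_assoc, h.tp.z_sq, mul_one] at h1
  exact SemiconjBy.mul_left h1 h.bw

theorem Good.quotWZ {G : Type u} [Group G] [Finite G] {a b : G} {α β : ℕ}
    (h : Good a b (α + 1) (β + 1)) (hα : 1 ≤ α) :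
    ∃ N : Subgroup G, ∃ _ : N.Normal,
      (∀ g, g ∈ N → ∃ w' z', (w' = 1 ∨ w' = a ^ (2 ^ (α + 1))) ∧ (z' = 1 ∨ z' = b ^ (2 ^ (β + 1))) ∧
        g = w' * z') ∧
      Good (a : G ⧸ N) (b : G ⧸ N) α β := by
  have hle := h.le
  have hcz := h.tp.core (by omega)
  have hcwz : Commute (a ^ (2 ^ (α + 1))) (b ^ (2 ^ (β + 1))) := hcz.pow_left _
  obtain ⟨N, hN, hm⟩ := h.tp.exN (a ^ (2 ^ (α + 1))) (b ^ (2 ^ (β + 1))) _ _ rfl rfl hcwz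
    ⟨1, 1, by simpa using h.bw.eq⟩ ⟨0, 1, by simpa using hcz.eq⟩
  have hq := h.tp.quot (Nat.le_succ _) (Nat.le_succ _) N hm
  have hm' : ∀ g, g ∈ N → ∃ w' z', (w' = 1 ∨ w' = a ^ (2 ^ (α + 1))) ∧
      (z' = 1 ∨ z' = b ^ (2 ^ (β + 1))) ∧ g = w' * z' := by
    intro g hg
    obtain ⟨k, l, rfl⟩ := (hm g).1 hg
    exact ⟨_, _, zpow_of_sq h.tp.swap.z_sq k, zpow_of_sq h.tp.z_sq l, rfl⟩
  refine ⟨N, hN, hm', hq, hα, by omega, ?_⟩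
  rcases lemA β hq hα (by omega) with hc | hc
  · exfalso
    have hz2 := h.tp.z_sq
    have hw2 := h.tp.swap.z_sq
    have hz := h.tp.z_ne
    have hbw := h.bw
    set z := b ^ (2 ^ (β + 1)) with hzdef
    set v := a ^ (2 ^ α) with hv
    set w := a ^ (2 ^ (α + 1)) with hw
    have hvv : v * v = w := by rw [hv, ← pow_add, ← two_mul, ← pow_succ', hw]
    have hvw : Commute v w := (Commute.refl a).pow_pow _ _
    have hvz : Commute v z := hcz.pow_left _
    have hc : ((b * v : G) : G ⧸ N) = ((v * b : G) : G ⧸ N) := hc.eq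
    have : ((b * v * b⁻¹ : G) : G ⧸ N) = (v : G ⧸ N) := by
      rw [QuotientGroup.mk_mul, hc, ← QuotientGroup.mk_mul, mul_inv_cancel_right]
    obtain ⟨n, hn, e⟩ := mk_eq_imp this
    have hn2 : n * n = 1 ∧ Commute v n := by
      obtain ⟨w', z', h1, h2, rfl⟩ := hm' n hn
      have h1' : w' * w' = 1 ∧ Commute v w' ∧ Commute w' z := by
        rcases h1 with rfl | rfl
        · exact ⟨by simp, Commute.one_right _, Commute.one_left _⟩
        · exact ⟨hw2, hvw, hcwz⟩
      have h2' : z' * z' = 1 ∧ Commute v z' ∧ Commute w' z' := by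
        rcases h2 with rfl | rfl
        · exact ⟨by simp, Commute.one_right _, Commute.one_right _⟩
        · exact ⟨hz2, hvz, h1'.2.2⟩
      refine ⟨?_, h1'.2.1.mul_right h2'.2.1⟩
      rw [mul_assoc, ← mul_assoc z', ← h2'.2.2.eq, mul_assoc w', h2'.1, mul_one, h1'.1]
    have h3 : b * w * b⁻¹ = w := by
      have : b * w * b⁻¹ = (b * v * b⁻¹) * (b * v * b⁻¹) := by rw [← hvv]; group
      rw [this, e, mul_assoc, ← mul_assoc n, ← hn2.2.eq, mul_assoc v n n, hn2.1, mul_one, hvv]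
    have h4 : b * w * b⁻¹ = w * z := mul_inv_eq_iff_eq_mul.2 hbw.eq
    rw [h3] at h4
    exact hz (by simpa using h4)
  · exact mul_inv_eq_iff_eq_mul.1 hc

end middle

section reg

universe u

theorem TP.ba {G : Type*} [Group G] {a b : G} {α β : ℕ} (h : TP a b α β) : b * a = a⁻¹ * b⁻¹ := by
  have h1 := h.swap.ab
  have : b * a = (b * a)⁻¹ := eq_inv_of_mul_eq_one_left h1
  rw [this]; group

theorem TP.regular {G : Type*} [Group G] {a b : G} {α β : ℕ} (h : TP a b α β)
    (H : ∀ k : ℤ, ∃ i j : ℤ, b * (a * a) ^ k * b⁻¹ = a ^ i * b ^ j ∧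
      b⁻¹ * ((a * a) ^ k)⁻¹ * b = a ^ (-i) * b ^ (-j)) :
    IsOrientablyRegular a b := by
  set A : G × G := (a, a⁻¹) with hA
  set B : G × G := (b, b⁻¹) with hB
  have hBA : B * A = A⁻¹ * B⁻¹ := by
    ext
    · simpa [hA, hB] using h.ba
    · simpa [hA, hB] using h.swap.ba.symm
  have hBA' : B⁻¹ * A⁻¹ = A * B := by
    have h3 : B * A * (B * A) = 1 := by
      nth_rewrite 2 [hBA]; group
    have h4 : A * B * (A * B) = 1 := by
      have : A * B * (A * B) = B⁻¹ * (B * A * (B * A)) * B := by group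
      rw [this, h3]; group
    rw [← mul_inv_rev]
    exact inv_eq_of_mul_eq_one_left h4
  have hev : ∀ k : ℤ, ∃ i j : ℤ, B * (A * A) ^ k = A ^ i * B ^ j := by
    intro k
    obtain ⟨i, j, h1, h2⟩ := H k
    refine ⟨i, j + 1, ?_⟩
    rw [zpow_add, ← mul_assoc, zpow_one, ← mul_inv_eq_iff_eq_mul]
    ext
    · simpa [hA, hB] using h1
    · have e : (a⁻¹ * a⁻¹) ^ k = ((a * a) ^ k)⁻¹ := by rw [← mul_inv_rev, inv_zpow]
      simpa [hA, hB, e] using h2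
  have hev' : ∀ k : ℤ, ∃ i j : ℤ, B⁻¹ * (A * A) ^ k = A ^ i * B ^ j := by
    intro k
    obtain ⟨i, j, h1, h2⟩ := H (-k)
    refine ⟨-i, -j - 1, ?_⟩
    rw [zpow_sub, ← mul_assoc, zpow_one, ← mul_inv_eq_iff_eq_mul, inv_inv]
    ext
    · simpa [hA, hB] using h2
    · have e : (a⁻¹ * a⁻¹) ^ k = ((a * a) ^ k)⁻¹ := by rw [← mul_inv_rev, inv_zpow]
      simpa [hA, hB, e] using h1
  have hsplit : ∀ n : ℤ, ∃ k : ℤ, A ^ n = (A * A) ^ k ∨ A ^ n = A * (A * A) ^ k := by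
    intro n
    rcases Int.even_or_odd' n with ⟨r, rfl | rfl⟩
    · refine ⟨r, Or.inl ?_⟩
      rw [zpow_mul, zpow_ofNat, pow_two]
    · refine ⟨r, Or.inr ?_⟩
      rw [add_comm, zpow_add, zpow_mul, zpow_one, zpow_ofNat, pow_two]
  have hB1 : ∀ n : ℤ, ∃ i j : ℤ, B * A ^ n = A ^ i * B ^ j := by
    intro n
    obtain ⟨k, e | e⟩ := hsplit n
    · rw [e]; exact hev k
    · obtain ⟨i, j, h1⟩ := hev' k
      refine ⟨-1 + i, j, ?_⟩
      rw [e, ← mul_assoc, hBA, mul_assoc, h1, zpow_add, zpow_neg_one, mul_assoc]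
  have hB2 : ∀ n : ℤ, ∃ i j : ℤ, B⁻¹ * A ^ n = A ^ i * B ^ j := by
    intro n
    obtain ⟨k, e | e⟩ := hsplit n
    · rw [e]; exact hev' k
    · obtain ⟨i, j, h1⟩ := hev (k + 1)
      refine ⟨1 + i, j, ?_⟩
      have : A * (A * A) ^ k = A⁻¹ * (A * A) ^ (k + 1) := by
        rw [add_comm, zpow_add, zpow_one]; simp only [mul_assoc, inv_mul_cancel_left]
      rw [e, this, ← mul_assoc, hBA', mul_assoc, h1, zpow_add, zpow_one, mul_assoc]
  have hBm : ∀ m n : ℤ, ∃ i j : ℤ, B ^ m * A ^ n = A ^ i * B ^ j := by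
    intro m
    induction m with
    | zero => intro n; exact ⟨n, 0, by simp⟩
    | succ m ih =>
      intro n
      obtain ⟨i, j, h1⟩ := hB1 n
      obtain ⟨i', j', h2⟩ := ih i
      refine ⟨i', j' + j, ?_⟩
      rw [zpow_add, zpow_one, mul_assoc, h1, ← mul_assoc, h2, mul_assoc, zpow_add]
    | pred m ih =>
      intro n
      obtain ⟨i, j, h1⟩ := hB2 n
      obtain ⟨i', j', h2⟩ := ih i
      refine ⟨i', j' + j, ?_⟩
      rw [zpow_sub, zpow_one, mul_assoc, h1, ← mul_assoc, h2, mul_assoc, zpow_add]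
  have hAB : ∀ x y : ℤ, A ^ x * B ^ y = (a ^ x * b ^ y, a ^ (-x) * b ^ (-y)) := by
    intro x y; ext <;> simp [hA, hB]
  choose X Y hXY using h.tight
  let f : G → G := fun g => a ^ (-(X g)) * b ^ (-(Y g))
  have hf : ∀ x y : ℤ, f (a ^ x * b ^ y) = a ^ (-x) * b ^ (-y) := by
    intro x y
    have e := hXY (a ^ x * b ^ y)
    obtain ⟨d1, d2⟩ := h.eq_of_eq e
    have e1 : a ^ (-(X (a ^ x * b ^ y))) = a ^ (-x) := by
      have := zpow_eq_one_of_dvd_two h.ha d1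
      rw [zpow_neg, zpow_neg, inv_inj]
      rw [zpow_sub] at this
      exact (mul_inv_eq_one.1 this).symm
    have e2 : b ^ (-(Y (a ^ x * b ^ y))) = b ^ (-y) := by
      have := zpow_eq_one_of_dvd_two h.hb d2
      rw [zpow_neg, zpow_neg, inv_inj]
      rw [zpow_sub] at this
      exact (mul_inv_eq_one.1 this).symm
    show a ^ (-(X (a ^ x * b ^ y))) * b ^ (-(Y (a ^ x * b ^ y))) = _
    rw [e1, e2]
  have hff : ∀ g, f (f g) = g := by
    intro g
    conv_rhs => rw [hXY g]
    show f (a ^ (-(X g)) * b ^ (-(Y g))) = _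
    rw [hf]; simp
  have hmul : ∀ g g', f (g * g') = f g * f g' := by
    intro g g'
    obtain ⟨i, j, h1⟩ := hBm (Y g) (X g')
    have h2 : (A ^ X g * B ^ Y g) * (A ^ X g' * B ^ Y g') = A ^ (X g + i) * B ^ (j + Y g') := by
      rw [mul_assoc, ← mul_assoc (B ^ Y g), h1, zpow_add, zpow_add]
      simp only [mul_assoc]
    rw [hAB, hAB, hAB, Prod.mk_mul_mk, Prod.mk.injEq, ← hXY, ← hXY] at h2
    rw [h2.1, hf]
    exact h2.2.symm
  refine ⟨{ toFun := f, invFun := f, left_inv := hff, right_inv := hff, map_mul' := hmul }, ?_, ?_⟩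
  · show f a = a⁻¹
    have := hf 1 0
    simpa using this
  · show f b = b⁻¹
    have := hf 0 1
    simpa using this

/-- First-order mirror symmetry. -/
def Reg1 {G : Type*} [Group G] (a b : G) : Prop :=
  ∃ i j : ℤ, b * (a * a) * b⁻¹ = a ^ i * b ^ j ∧ b⁻¹ * (a * a)⁻¹ * b = a ^ (-i) * b ^ (-j)

theorem Reg1.map {G H : Type*} [Group G] [Group H] {a b : G} (h : Reg1 a b) (f : G →* H) :
    Reg1 (f a) (f b) := by
  obtain ⟨i, j, h1, h2⟩ := h
  exact ⟨i, j, by simpa using congrArg f h1, by simpa using congrArg f h2⟩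

theorem TP.reg1_eq {G : Type*} [Group G] {a b : G} {α β : ℕ} (h : TP a b α β) (hr : Reg1 a b)
    {i j : ℤ} (e : b * (a * a) * b⁻¹ = a ^ i * b ^ j) :
    b⁻¹ * (a * a)⁻¹ * b = a ^ (-i) * b ^ (-j) := by
  obtain ⟨k, l, h1, h2⟩ := hr
  rw [e] at h1
  obtain ⟨d1, d2⟩ := h.eq_of_eq h1
  have e1 := zpow_eq_one_of_dvd_two h.ha d1
  have e2 := zpow_eq_one_of_dvd_two h.hb d2
  rw [zpow_sub, mul_inv_eq_one] at e1 e2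
  rw [h2, zpow_neg, zpow_neg, zpow_neg, zpow_neg, e1, e2]

/-- The basic identity. -/
theorem TP.abb {G : Type*} [Group G] {a b : G} {α β : ℕ} (h : TP a b α β) :
    a * (b * b) * a⁻¹ = b⁻¹ * b⁻¹ * (b * (a * a) * b⁻¹)⁻¹ * (a * a)⁻¹ := by
  have h1 : b * a = a⁻¹ * b⁻¹ := h.ba
  have h2 : a * b = b⁻¹ * a⁻¹ := h.swap.ba
  have : a * (b * b) * a⁻¹ = (a * b) * (b * a) * (a * a)⁻¹ := by group
  rw [this, h1, h2]
  have e3 : b⁻¹ * a⁻¹ * (a⁻¹ * b⁻¹) * (a * a)⁻¹ = b⁻¹ * b⁻¹ * (b * (a * a)⁻¹ * b⁻¹) * (a * a)⁻¹ := by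
    group
  rw [e3]; group

end reg

section three

universe u

theorem TP.ad {G : Type*} [Group G] [Finite G] {a b : G} {α β : ℕ}
    (h : TP a b α (β + 1 + 1)) (hle : α ≤ β + 1) :
    Commute a (b ^ (2 ^ β)) ∨ SemiconjBy a (b ^ (2 ^ β)) (b ^ (2 ^ β))⁻¹ := by
  obtain ⟨N, hN, hm, hq⟩ := h.quotZ (by omega)
  have hz2 := h.z_sq
  have hda := hq.core (by omega)
  have hda : ((a * b ^ (2 ^ β) : G) : G ⧸ N) = ((b ^ (2 ^ β) * a : G) : G ⧸ N) := hda.eq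
  have : ((a * b ^ (2 ^ β) * a⁻¹ : G) : G ⧸ N) = ((b ^ (2 ^ β) : G) : G ⧸ N) := by
    rw [QuotientGroup.mk_mul, hda, ← QuotientGroup.mk_mul, mul_inv_cancel_right]
  obtain ⟨n, hn, e⟩ := mk_eq_imp this
  rcases hm n hn with rfl | rfl
  · left; rw [mul_one] at e; exact mul_inv_eq_iff_eq_mul.1 e
  · right
    have : b ^ (2 ^ β) * b ^ (2 ^ (β + 1)) = (b ^ (2 ^ β))⁻¹ := by
      rw [eq_inv_iff_mul_eq_one, ← pow_add, ← pow_add, ← h.hb]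
      congr 1; ring
    rw [this] at e
    exact mul_inv_eq_iff_eq_mul.1 e

theorem lemT {G : Type*} [Group G] {a b v W W' D D' : G} (hab : a * b * (a * b) = 1)
    (h1 : SemiconjBy b v (v * W * D)) (h2 : Commute a v) (h3 : Commute a W)
    (h4 : SemiconjBy a D D') (h5 : SemiconjBy a D' D) (h6 : SemiconjBy b W W')
    (h7 : Commute b D') (h8 : Commute a W') : W * D' * W' * D = 1 := by
  have s1 : SemiconjBy (a * b) v (v * W * D') :=
    SemiconjBy.mul_left (SemiconjBy.mul_right (SemiconjBy.mul_right h2 h3) h4) h1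
  have s2 : SemiconjBy (a * b) W W' := SemiconjBy.mul_left h8 h6
  have s3 : SemiconjBy (a * b) D' D := SemiconjBy.mul_left h5 h7
  have s4 := SemiconjBy.mul_left ((s1.mul_right s2).mul_right s3) s1
  rw [hab] at s4
  have s5 := s4.eq
  rw [one_mul, mul_one] at s5
  have : v * (W * D' * W' * D) = v * 1 := by
    rw [mul_one]; conv_rhs => rw [s5]
    simp only [mul_assoc]
  exact mul_left_cancel this

theorem lemSq {G : Type*} [Group G] {a b W D : G} (h : a * (b * b) * a⁻¹ = b⁻¹ * b⁻¹ * D⁻¹ * W)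
    (h1 : Commute (b * b) W) (h2 : Commute D W) (h3 : Commute b D) (h4 : W * W = 1) :
    SemiconjBy a (b ^ 4) ((b ^ 4)⁻¹ * (D * D)⁻¹) := by
  have s : SemiconjBy a (b * b) (b⁻¹ * b⁻¹ * D⁻¹ * W) := mul_inv_eq_iff_eq_mul.1 h
  have s2 := s.mul_right s
  have e1 : b * b * (b * b) = b ^ 4 := by simp only [pow_succ, pow_zero, one_mul, mul_assoc]
  have c1 : Commute (b⁻¹ * b⁻¹ * D⁻¹) W := by
    rw [← mul_inv_rev]; exact h1.inv_left.mul_left h2.inv_left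
  have c2 : Commute D⁻¹ (b⁻¹ * b⁻¹) := by
    rw [← mul_inv_rev]; exact ((h3.symm.mul_right h3.symm).inv_right).inv_left
  have e2 : b⁻¹ * b⁻¹ * D⁻¹ * W * (b⁻¹ * b⁻¹ * D⁻¹ * W) = (b ^ 4)⁻¹ * (D * D)⁻¹ := by
    rw [mul_assoc _ W, ← mul_assoc W, ← c1.eq, mul_assoc _ W W, h4, mul_one, mul_assoc (b⁻¹ * b⁻¹),
      ← mul_assoc D⁻¹, c2.eq]
    group
  rwa [e1, e2] at s2

theorem lem3 {G : Type u} [Group G] [Finite G] {a b : G} {β : ℕ} (h : Good a b 2 (β + 1)) :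
    ∃ D, (D = b ^ (2 ^ β) ∨ D = (b ^ (2 ^ β))⁻¹) ∧
    ((3 ≤ β ∧ SemiconjBy a D D⁻¹ ∧ b * (a * a) * b⁻¹ = a * a * D) ∨
     (β = 2 ∧ Commute a D ∧ b * (a * a) * b⁻¹ = (a * a)⁻¹ * D)) := by
  have hle := h.le
  obtain ⟨N, hN, hm, hq⟩ := Good.quotWZ (α := 1) h le_rfl
  have hqb := hq.bw.eq
  have e0 : a ^ 2 ^ 1 = a * a := by rw [pow_one, pow_two]
  have hqb : ((b * (a * a) : G) : G ⧸ N) = ((a * a * b ^ (2 ^ β) * b : G) : G ⧸ N) := by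
    rw [← e0]; exact hqb
  have : ((b * (a * a) * b⁻¹ : G) : G ⧸ N) = ((a * a * b ^ (2 ^ β) : G) : G ⧸ N) := by
    rw [QuotientGroup.mk_mul, hqb, ← QuotientGroup.mk_mul, mul_inv_cancel_right]
  obtain ⟨n, hn, e⟩ := mk_eq_imp this
  obtain ⟨w', z', hw', hz', rfl⟩ := hm n hn
  have had := h.tp.ad (by omega)
  have hz2 := h.tp.z_sq
  have hw2 := h.tp.swap.z_sq
  have hz := h.tp.z_ne
  have hbw := h.bw
  have hbbw := h.bbw
  have hcz : Commute a (b ^ (2 ^ (β + 1))) := h.tp.core (by omega)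
  have habb := h.tp.abb
  have hpow : ∀ k, β = k + 2 → b ^ (2 ^ β) = (b ^ 4) ^ (2 ^ k) := by
    rintro k rfl
    rw [← pow_mul]; congr 1; ring
  have hw : a ^ 2 ^ (1 + 1) = a ^ (2 ^ 2) := rfl
  rw [hw] at hw'
  have hwaa : a ^ (2 ^ 2) = a * a * (a * a) := by rw [pow_two 2, pow_mul, pow_two, pow_two]
  set z := b ^ (2 ^ (β + 1)) with hzdef
  set d := b ^ (2 ^ β) with hd
  set w := a ^ (2 ^ 2) with hwdef
  have hdd : d * d = z := by rw [hd, ← pow_add, ← two_mul, ← pow_succ', hzdef]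
  have hbd : Commute b d := (Commute.refl b).pow_right _
  have hbz : Commute b z := (Commute.refl b).pow_right _
  have haw : Commute a w := (Commute.refl a).pow_right _
  have hdz : d * z = d⁻¹ := by
    rw [eq_inv_iff_mul_eq_one, ← hdd]
    calc d * (d * d) * d = d * d * (d * d) := by group
      _ = 1 := by rw [hdd, hz2]
  -- the element D
  have hD : d * z' = d ∨ d * z' = d⁻¹ := by
    rcases hz' with rfl | rfl
    · left; simp
    · right; exact hdz
  have haD : Commute a (d * z') ∨ SemiconjBy a (d * z') (d * z')⁻¹ := by
    rcases hD with hD | hD <;> rw [hD]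
    · exact had
    · rcases had with had | had
      · left; exact had.inv_right
      · right; exact had.inv_right
  have hDD : (d * z') * (d * z') = z := by
    rcases hD with hD | hD <;> rw [hD]
    · exact hdd
    · rw [← mul_inv_rev, hdd]; exact inv_eq_of_mul_eq_one_left hz2
  have hbD : Commute b (d * z') := by
    rcases hD with hD | hD <;> rw [hD]
    · exact hbd
    · exact hbd.inv_right
  have haad : Commute (a * a) d := by
    rcases had with had | had
    · exact had.mul_left had
    · have := had.inv_right; rw [inv_inv] at this; exact SemiconjBy.mul_left this had
  have hwd : Commute w d := by rw [hwaa]; exact haad.mul_left haad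
  have hw'd : Commute w' d := by
    rcases hw' with rfl | rfl
    · exact Commute.one_left _
    · exact hwd
  have haw' : Commute a w' := by
    rcases hw' with rfl | rfl
    · exact Commute.one_right _
    · exact haw
  have e' : b * (a * a) * b⁻¹ = a * a * w' * (d * z') := by
    rw [e, mul_assoc (a * a) d, ← mul_assoc d, ← hw'd.eq]; simp only [mul_assoc]
  have hwD : Commute (d * z') w := by
    rcases hD with hD | hD <;> rw [hD]
    · exact hwd.symm
    · exact hwd.symm.inv_left
  generalize hDdef : d * z' = D at *
  have hs : SemiconjBy b (a * a) (a * a * w' * D) := mul_inv_eq_iff_eq_mul.1 e'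
  have haa : Commute a (a * a) := (Commute.refl a).mul_right (Commute.refl a)
  refine ⟨D, hD, ?_⟩
  rcases haD with haD | haD
  · -- `a` commutes with `D`
    right
    have hw'w : w' = w := by
      rcases hw' with rfl | hw'
      · exfalso
        have := lemT (W' := 1) h.tp.ab hs haa haw' haD haD (by exact SemiconjBy.one_right _) hbD
          (Commute.one_right _)
        rw [one_mul, mul_one, hDD] at this
        exact hz this
      · exact hw'
    subst hw'w
    have e2 : b * (a * a) * b⁻¹ = (a * a)⁻¹ * D := by
      rw [e']; congr 1
      rw [eq_inv_iff_mul_eq_one, ← hw2, hwaa]; group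
    refine ⟨?_, haD, e2⟩
    by_contra hβ
    have habb2 : a * (b * b) * a⁻¹ = b⁻¹ * b⁻¹ * D⁻¹ * 1 := by
      rw [habb, e2]; group
    have hsq := lemSq habb2 (Commute.one_right _) (Commute.one_right _) hbD (by simp)
    rw [hDD] at hsq
    obtain ⟨k, hk⟩ : ∃ k, β = k + 1 + 2 := ⟨β - 3, by omega⟩
    have hsq2 := hsq.pow_right (2 ^ (k + 1))
    rw [← hpow _ hk] at hsq2
    have hc4 : Commute (b ^ 4)⁻¹ z⁻¹ := ((hbz.pow_left 4).inv_left).inv_right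
    rw [hc4.mul_pow, inv_pow, inv_pow, ← hpow _ hk, pow_succ', pow_mul z, pow_two, hz2, one_pow,
      inv_one, mul_one] at hsq2
    have had2 : Commute a d := by
      rcases hD with hD | hD
      · rwa [hD] at haD
      · rw [hD] at haD; simpa using haD.inv_right
    have : d = d⁻¹ := mul_right_cancel (had2.eq.symm.trans hsq2.eq)
    rw [eq_inv_iff_mul_eq_one, hdd] at this
    exact hz this
  · left
    have hw'1 : w' = 1 := by
      rcases hw' with hw' | rfl
      · exact hw'
      · exfalso
        have := lemT (W' := w * z) h.tp.ab hs haa haw haD (by simpa using haD.inv_right) hbw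
          hbD.inv_right (haw.mul_right hcz)
        have e3 : w * D⁻¹ * (w * z) * D = z := by
          have c := hwD.inv_left.eq
          calc w * D⁻¹ * (w * z) * D = w * (D⁻¹ * w) * z * D := by simp only [mul_assoc]
            _ = w * w * (D⁻¹ * z * D) := by rw [c]; simp only [mul_assoc]
            _ = z := by rw [hw2, one_mul, ← hDD]; group
        rw [e3] at this
        exact hz this
    subst hw'1
    rw [mul_one] at e'
    refine ⟨?_, haD, e'⟩
    by_contra hβ
    have hk : β = 0 + 2 := by omega
    have habb2 : a * (b * b) * a⁻¹ = b⁻¹ * b⁻¹ * D⁻¹ * w⁻¹ := by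
      rw [habb, e', hwaa]; group
    have hsq := lemSq habb2 hbbw.inv_right hwD.inv_right hbD (by rw [← mul_inv_rev, hw2, inv_one])
    rw [hDD] at hsq
    have h4 : d = b ^ 4 := by rw [hpow 0 hk, pow_zero, pow_one]
    rw [← h4] at hsq
    have had2 : SemiconjBy a d d⁻¹ := by
      rcases hD with hD | hD
      · rwa [hD] at haD
      · rw [hD] at haD; simpa using haD.inv_right
    have : d⁻¹ = d⁻¹ * z⁻¹ := mul_right_cancel (had2.eq.symm.trans hsq.eq)
    apply hz
    simpa using this

end three

section five

universe u

theorem TP.regular1 {G : Type*} [Group G] {a b : G} {α β : ℕ} (h : TP a b α β) {i j : ℤ}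
    (h1 : b * (a * a) * b⁻¹ = a ^ i * b ^ j)
    (h2 : b⁻¹ * (a * a)⁻¹ * b = a ^ (-i) * b ^ (-j))
    (hc : Commute (a ^ i) (b ^ j)) : IsOrientablyRegular a b := by
  apply h.regular
  intro k
  refine ⟨i * k, j * k, ?_, ?_⟩
  · rw [← conj_zpow, h1, hc.mul_zpow, zpow_mul, zpow_mul]
  · have e : b⁻¹ * ((a * a) ^ k)⁻¹ * b = (b⁻¹ * (a * a)⁻¹ * b) ^ k := by
      have := conj_zpow (i := k) (a := b⁻¹) (b := (a * a)⁻¹)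
      rw [inv_inv] at this
      rw [this, inv_zpow]
    have hc2 : Commute (a ^ (-i)) (b ^ (-j)) := by
      rw [zpow_neg, zpow_neg]; exact hc.inv_left.inv_right
    rw [e, h2, hc2.mul_zpow, ← zpow_mul, ← zpow_mul, neg_mul, neg_mul]

theorem lemE {G : Type*} [Group G] {a b w D : G} {m : ℤ}
    (habb : a * (b * b) * a⁻¹ = b⁻¹ * b⁻¹ * (b * (a * a) * b⁻¹)⁻¹ * (a * a)⁻¹)
    (hs : b * (a * a) * b⁻¹ = (a * a)⁻¹ * w * D * (b ^ 4)⁻¹)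
    (hw : w * w = 1) (haw : Commute a w) (hbw : Commute (b * b) w)
    (hD : D = (b ^ 8) ^ m) (hDD : D * D * (D * D) = 1) (haZ : Commute a (D * D)) :
    Commute a D ∧ SemiconjBy (b * b) (a * a) (a * a * (D * D)) ∧
    SemiconjBy a (b ^ 4) (b ^ 4 * (D * D)) ∧ b * w * b⁻¹ = w * (D * D) ∧
    b⁻¹ * (a * a)⁻¹ * b = a * a * w * b ^ 4 * D := by
  have hb4 : b ^ 4 = b * b * (b * b) := by simp only [pow_succ, pow_zero, one_mul, mul_assoc]
  have hb8 : b ^ 8 = b ^ 4 * b ^ 4 := by rw [← pow_add]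
  have hbD : Commute b D := by rw [hD]; exact ((Commute.refl b).pow_right 8).zpow_right m
  have hb4w : Commute (b ^ 4) w := by rw [hb4]; exact hbw.mul_left hbw
  have hDw : Commute D w := by
    rw [hD, hb8]; exact (hb4w.mul_left hb4w).zpow_left m
  have hbbD : Commute (b * b) D := hbD.mul_left hbD
  have hb4D : Commute (b ^ 4) D := hbD.pow_left 4
  have hwi : w⁻¹ = w := inv_eq_of_mul_eq_one_left hw
  have hbZ : Commute b (D * D) := hbD.mul_right hbD
  have hZi : (D * D)⁻¹ = D * D := inv_eq_of_mul_eq_one_left hDD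
  have haa_w : Commute (a * a) w := haw.mul_left haw
  -- conjugating `b * b` by `a`
  have s1 : SemiconjBy a (b * b) (b * b * D⁻¹ * w) := by
    apply mul_inv_eq_iff_eq_mul.1
    rw [habb, hs]
    have : ((a * a)⁻¹ * w * D * (b ^ 4)⁻¹)⁻¹ = b ^ 4 * D⁻¹ * w⁻¹ * (a * a) := by
      simp only [mul_inv_rev, inv_inv, mul_assoc]
    rw [this, hwi, hb4]; simp only [mul_inv_rev, inv_inv, mul_assoc, inv_mul_cancel_left, mul_inv_cancel_left, mul_inv_cancel, mul_one]
  have s2 : SemiconjBy a (b ^ 4) (b ^ 4 * (D * D)) := by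
    have := s1.mul_right s1
    rw [← hb4] at this
    have e : b * b * D⁻¹ * w * (b * b * D⁻¹ * w) = b ^ 4 * (D * D) := by
      have c1 : Commute (b * b * D⁻¹) w := hbw.mul_left hDw.inv_left
      have c2 : Commute (b * b) D⁻¹ := hbbD.inv_right
      calc b * b * D⁻¹ * w * (b * b * D⁻¹ * w)
          = b * b * D⁻¹ * (w * (b * b * D⁻¹)) * w := by simp only [mul_assoc]
        _ = b * b * D⁻¹ * (b * b * D⁻¹) * (w * w) := by rw [← c1.eq]; simp only [mul_assoc]
        _ = b * b * (D⁻¹ * (b * b)) * D⁻¹ := by rw [hw, mul_one]; simp only [mul_assoc]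
        _ = b ^ 4 * (D * D)⁻¹ := by rw [← c2.eq, hb4]; group
        _ = b ^ 4 * (D * D) := by rw [hZi]
    rwa [e] at this
  have s3 : Commute a (b ^ 8) := by
    have := s2.mul_right s2
    have e : b ^ 4 * (D * D) * (b ^ 4 * (D * D)) = b ^ 8 := by
      have c : Commute (b ^ 4) (D * D) := hb4D.mul_right hb4D
      calc b ^ 4 * (D * D) * (b ^ 4 * (D * D)) = b ^ 4 * ((D * D) * b ^ 4) * (D * D) := by
            simp only [mul_assoc]
        _ = b ^ 4 * b ^ 4 * (D * D * (D * D)) := by rw [← c.eq]; simp only [mul_assoc]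
        _ = b ^ 8 := by rw [hDD, mul_one, hb8]
    rwa [e, ← hb8] at this
  have haD : Commute a D := by rw [hD]; exact s3.zpow_right m
  have haaD : Commute (a * a) D := haD.mul_left haD
  have haaZ : Commute (a * a) (D * D) := haaD.mul_right haaD
  have s4 : SemiconjBy (a * a) (b * b) (b * b * (D * D)) := by
    have t1 : SemiconjBy a (b * b * D⁻¹ * w) (b * b * D⁻¹ * w * D⁻¹ * w) :=
      SemiconjBy.mul_right (SemiconjBy.mul_right s1 haD.inv_right) haw |>.trans (by rfl)
    have := SemiconjBy.mul_left t1 s1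
    have e : b * b * D⁻¹ * w * D⁻¹ * w = b * b * (D * D) := by
      have c := hDw.inv_left.eq
      calc b * b * D⁻¹ * w * D⁻¹ * w = b * b * D⁻¹ * w * (D⁻¹ * w) := by simp only [mul_assoc]
        _ = b * b * D⁻¹ * (w * w) * D⁻¹ := by rw [c]; simp only [mul_assoc]
        _ = b * b * (D * D)⁻¹ := by rw [hw]; group
        _ = _ := by rw [hZi]
    rwa [e] at this
  have s5 : SemiconjBy (b * b) (a * a) (a * a * (D * D)) := by
    have h1 := s4.eq
    show b * b * (a * a) = a * a * (D * D) * (b * b)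
    have c : Commute (b * b) (D * D) := hbZ.mul_left hbZ
    have : a * a * (D * D) * (b * b) = a * a * (b * b) * (D * D) := by
      rw [mul_assoc, ← c.eq]; simp only [mul_assoc]
    rw [this, h1]
    calc b * b * (a * a) = b * b * (a * a) * (D * D * (D * D)) := by rw [hDD, mul_one]
      _ = b * b * ((a * a) * (D * D)) * (D * D) := by simp only [mul_assoc]
      _ = _ := by rw [haaZ.eq]; simp only [mul_assoc]
  have s6 : Commute (b ^ 4) (a * a) := by
    rw [hb4]
    have t : SemiconjBy (b * b) (a * a * (D * D)) (a * a * (D * D) * (D * D)) :=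
      s5.mul_right (hbZ.mul_left hbZ)
    rw [mul_assoc (a * a), hDD, mul_one] at t
    exact SemiconjBy.mul_left t s5
  refine ⟨haD, s5, s2, ?_, ?_⟩
  · have e1 : b * b * (a * a) * (b * b)⁻¹ = a * a * (D * D) := mul_inv_eq_iff_eq_mul.2 s5
    have e2 : b * b * (a * a) * (b * b)⁻¹ = b * (b * (a * a) * b⁻¹) * b⁻¹ := by group
    have e3 : b * ((a * a)⁻¹ * w * D * (b ^ 4)⁻¹) * b⁻¹
        = (b * (a * a) * b⁻¹)⁻¹ * (b * w * b⁻¹) * (b * D * b⁻¹) * (b ^ 4)⁻¹ := by group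
    have e4 : b * D * b⁻¹ = D := by rw [hbD.eq]; group
    rw [e2, hs, e3, e4, hs] at e1
    have e5 : ((a * a)⁻¹ * w * D * (b ^ 4)⁻¹)⁻¹ = a * a * w * b ^ 4 * D⁻¹ := by
      have : ((a * a)⁻¹ * w * D * (b ^ 4)⁻¹)⁻¹ = b ^ 4 * (D⁻¹ * w⁻¹) * (a * a) := by
        simp only [mul_inv_rev, inv_inv, mul_assoc]
      rw [this, hwi, hDw.inv_left.eq]
      calc b ^ 4 * (w * D⁻¹) * (a * a) = (b ^ 4 * w) * (D⁻¹ * (a * a)) := by simp only [mul_assoc]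
        _ = w * (b ^ 4 * (a * a)) * D⁻¹ := by
            rw [hb4w.eq, ← haaD.inv_right.eq]; simp only [mul_assoc]
        _ = w * (a * a) * b ^ 4 * D⁻¹ := by rw [s6.eq]; simp only [mul_assoc]
        _ = _ := by rw [haa_w.eq]
    rw [e5] at e1
    have hbw' : Commute (b * b) (b * w * b⁻¹) := by
      have c1 := hbw.eq
      have : b * b * (b * w * b⁻¹) = b * (b * b * w) * b⁻¹ := by group
      show b * b * (b * w * b⁻¹) = _
      rw [this, c1]; group
    have hb4w' : Commute (b ^ 4) (b * w * b⁻¹) := by rw [hb4]; exact hbw'.mul_left hbw'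
    have hDw' : Commute D (b * w * b⁻¹) := by
      rw [hD, hb8]; exact (hb4w'.mul_left hb4w').zpow_left m
    generalize b * w * b⁻¹ = w1 at *
    have e6 : a * a * w * b ^ 4 * D⁻¹ * w1 * D * (b ^ 4)⁻¹ = a * a * (w * w1) := by
      calc a * a * w * b ^ 4 * D⁻¹ * w1 * D * (b ^ 4)⁻¹
          = a * a * w * b ^ 4 * (D⁻¹ * (w1 * D)) * (b ^ 4)⁻¹ := by simp only [mul_assoc]
        _ = a * a * w * (b ^ 4 * w1) * (b ^ 4)⁻¹ := by
            rw [← hDw'.eq, inv_mul_cancel_left]; simp only [mul_assoc]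
        _ = _ := by rw [hb4w'.eq]; group
    rw [e6] at e1
    have e7 := mul_left_cancel e1
    rw [← e7, ← mul_assoc, hw, one_mul]
  · have e1 : b * b * (a * a) * (b * b)⁻¹ = a * a * (D * D) := mul_inv_eq_iff_eq_mul.2 s5
    have e2 : b⁻¹ * (a * a) * b = b * (a * a) * b⁻¹ * (D * D) := by
      have c := hbZ.inv_left.eq
      have : b * (a * a) * b⁻¹ = b⁻¹ * (b * b * (a * a) * (b * b)⁻¹) * b := by group
      rw [this, e1]
      calc b⁻¹ * (a * a) * b = b⁻¹ * (a * a) * (D * D * (D * D)) * b := by rw [hDD, mul_one]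
        _ = b⁻¹ * (a * a * (D * D)) * ((D * D) * b) := by simp only [mul_assoc]
        _ = _ := by rw [← hbZ.eq]; simp only [mul_assoc]
    have e3 : b⁻¹ * (a * a)⁻¹ * b = (b⁻¹ * (a * a) * b)⁻¹ := by group
    rw [e3, e2, hs, mul_inv_rev, hZi]
    have : ((a * a)⁻¹ * w * D * (b ^ 4)⁻¹)⁻¹ = b ^ 4 * (D⁻¹ * w⁻¹) * (a * a) := by
        simp only [mul_inv_rev, inv_inv, mul_assoc]
    rw [this, hwi]
    have hZw : Commute (D * D) w := hDw.mul_left hDw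
    calc D * D * (b ^ 4 * (D⁻¹ * w) * (a * a))
        = D * (D * b ^ 4) * D⁻¹ * (w * (a * a)) := by simp only [mul_assoc]
      _ = D * b ^ 4 * (a * a * w) := by
          rw [← hb4D.eq, ← haa_w.eq, ← mul_assoc D, mul_inv_cancel_right, hb4D.eq]
      _ = D * (b ^ 4 * (a * a)) * w := by simp only [mul_assoc]
      _ = D * (a * a) * (b ^ 4 * w) := by rw [s6.eq]; simp only [mul_assoc]
      _ = a * a * (D * w) * b ^ 4 := by rw [← haaD.eq, hb4w.eq]; simp only [mul_assoc]
      _ = a * a * w * (D * b ^ 4) := by rw [hDw.eq]; simp only [mul_assoc]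
      _ = _ := by rw [← hb4D.eq]; simp only [mul_assoc]

end five

section six

universe u

/-- Consequences of the mirror relation in the large case. -/
theorem Good.star {G : Type u} [Group G] [Finite G] {a b : G} {α : ℕ}
    (h : Good a b (α + 1) (α + 1 + 1)) (hα : 2 ≤ α) {w' : G} {t : ℤ}
    (hw' : w' = 1 ∨ w' = a ^ (2 ^ (α + 1)))
    (hs : b * (a * a) * b⁻¹ = (a * a)⁻¹ * w' * (b ^ (2 ^ (α + 1))) ^ t * (b ^ 4)⁻¹) :
    Commute a ((b ^ (2 ^ (α + 1))) ^ t) ∧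
    SemiconjBy (b * b) (a * a) (a * a * (b ^ (2 ^ (α + 1 + 1))) ^ t) ∧
    SemiconjBy a (b ^ 4) (b ^ 4 * (b ^ (2 ^ (α + 1 + 1))) ^ t) ∧
    b * w' * b⁻¹ = w' * (b ^ (2 ^ (α + 1 + 1))) ^ t ∧
    b⁻¹ * (a * a)⁻¹ * b = a * a * w' * b ^ 4 * (b ^ (2 ^ (α + 1))) ^ t := by
  have hz2 := h.tp.z_sq
  have hw2 := h.tp.swap.z_sq
  have hcz : Commute a (b ^ (2 ^ (α + 1 + 1))) := h.tp.core (by omega)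
  have hDD : (b ^ (2 ^ (α + 1))) ^ t * (b ^ (2 ^ (α + 1))) ^ t = (b ^ (2 ^ (α + 1 + 1))) ^ t := by
    rw [← (Commute.refl _).mul_zpow, ← pow_add, ← two_mul, ← pow_succ']
  have hpow : b ^ (2 ^ (α + 1)) = (b ^ 8) ^ (2 ^ (α - 2)) := by
    rw [← pow_mul]; congr 1
    obtain ⟨k, rfl⟩ : ∃ k, α = k + 2 := ⟨α - 2, by omega⟩
    simp only [Nat.add_sub_cancel]; ring
  have := lemE (w := w') (D := (b ^ (2 ^ (α + 1))) ^ t) (m := ((2 ^ (α - 2) : ℕ) : ℤ) * t)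
    h.tp.abb hs ?_ ?_ ?_ ?_ ?_ ?_
  · rwa [hDD] at this
  · rcases hw' with rfl | rfl
    · simp
    · exact hw2
  · rcases hw' with rfl | rfl
    · exact Commute.one_right _
    · exact (Commute.refl a).pow_right _
  · rcases hw' with rfl | rfl
    · exact Commute.one_right _
    · exact h.bbw
  · rw [zpow_mul, zpow_natCast, ← hpow]
  · rw [hDD, ← (Commute.refl _).mul_zpow, hz2, one_zpow]
  · rw [hDD]; exact hcz.zpow_right t

/-- Lifting the relation from the quotient. -/
theorem Good.lift {G : Type u} [Group G] [Finite G] {a b : G} {α : ℕ}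
    (h : Good a b (α + 1) (α + 1 + 1)) {N : Subgroup G} [N.Normal]
    (hm : ∀ g, g ∈ N → ∃ w' z', (w' = 1 ∨ w' = a ^ (2 ^ (α + 1))) ∧
      (z' = 1 ∨ z' = b ^ (2 ^ (α + 1 + 1))) ∧ g = w' * z') {s : ℤ}
    (hs : (b : G ⧸ N) * (a * a) * (b : G ⧸ N)⁻¹
      = ((a : G ⧸ N) * a)⁻¹ * ((b : G ⧸ N) ^ (2 ^ (α + 1))) ^ s * ((b : G ⧸ N) ^ 4)⁻¹) :
    ∃ (w' : G) (t : ℤ), (w' = 1 ∨ w' = a ^ (2 ^ (α + 1))) ∧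
      b * (a * a) * b⁻¹ = (a * a)⁻¹ * w' * (b ^ (2 ^ (α + 1))) ^ t * (b ^ 4)⁻¹ := by
  have hs : ((b * (a * a) * b⁻¹ : G) : G ⧸ N)
      = (((a * a)⁻¹ * (b ^ (2 ^ (α + 1))) ^ s * (b ^ 4)⁻¹ : G) : G ⧸ N) := hs
  obtain ⟨n, hn, e⟩ := mk_eq_imp hs
  obtain ⟨w', z', hw', hz', rfl⟩ := hm n hn
  have hbbw' : Commute (b * b) w' := by
    rcases hw' with rfl | rfl
    · exact Commute.one_right _
    · exact h.bbw
  have hb4 : b ^ 4 = (b * b) ^ 2 := by rw [← pow_two, ← pow_mul]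
  have hdd : b ^ (2 ^ (α + 1)) = (b * b) ^ (2 ^ α) := by
    rw [← pow_two, ← pow_mul, pow_succ']
  have hdz : b ^ (2 ^ (α + 1 + 1)) = (b ^ (2 ^ (α + 1))) ^ (2 : ℤ) := by
    rw [zpow_ofNat, ← pow_mul, pow_succ]
  have hc4 : Commute (b ^ 4) w' := by rw [hb4]; exact hbbw'.pow_left _
  have hcd : Commute (b ^ (2 ^ (α + 1))) w' := by rw [hdd]; exact hbbw'.pow_left _
  have hbd : Commute (b ^ 4) (b ^ (2 ^ (α + 1))) := ((Commute.refl b).pow_left _).pow_right _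
  obtain ⟨t, ht⟩ : ∃ t : ℤ, z' = (b ^ (2 ^ (α + 1))) ^ t := by
    rcases hz' with rfl | rfl
    · exact ⟨0, by simp⟩
    · exact ⟨2, hdz⟩
  refine ⟨w', s + t, hw', ?_⟩
  rw [e, ht, zpow_add]
  generalize b ^ (2 ^ (α + 1)) = d at *
  have c1 : Commute (d ^ s * (b ^ 4)⁻¹) w' := (hcd.zpow_left s).mul_left hc4.inv_left
  have c2 : Commute (b ^ 4)⁻¹ (d ^ t) := (hbd.inv_left).zpow_right t
  calc (a * a)⁻¹ * d ^ s * (b ^ 4)⁻¹ * (w' * d ^ t)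
      = (a * a)⁻¹ * ((d ^ s * (b ^ 4)⁻¹) * w') * d ^ t := by simp only [mul_assoc]
    _ = (a * a)⁻¹ * w' * d ^ s * ((b ^ 4)⁻¹ * d ^ t) := by rw [c1.eq]; simp only [mul_assoc]
    _ = _ := by rw [c2.eq]; simp only [mul_assoc]

/-- Parity information. -/
theorem Good.star_even {G : Type u} [Group G] [Finite G] {a b : G} {α : ℕ}
    (h : Good a b (α + 1) (α + 1 + 1)) {w' : G} {t : ℤ}
    (hw' : w' = 1 ∨ w' = a ^ (2 ^ (α + 1)))
    (hbw : b * w' * b⁻¹ = w' * (b ^ (2 ^ (α + 1 + 1))) ^ t) :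
    ((∃ s, t = 2 * s) ∧ w' = 1 ∧ (b ^ (2 ^ (α + 1 + 1))) ^ t = 1) ∨
    ((∃ s, t = 2 * s + 1) ∧ w' = a ^ (2 ^ (α + 1)) ∧
      (b ^ (2 ^ (α + 1 + 1))) ^ t = b ^ (2 ^ (α + 1 + 1))) := by
  have hz2 := h.tp.z_sq
  have hz := h.tp.z_ne
  have hz2' : (b ^ (2 ^ (α + 1 + 1))) ^ (2 : ℤ) = 1 := by rw [zpow_ofNat, pow_two, hz2]
  rcases Int.even_or_odd' t with ⟨r, rfl | rfl⟩
  · left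
    have e : (b ^ (2 ^ (α + 1 + 1))) ^ (2 * r) = 1 := by rw [zpow_mul, hz2', one_zpow]
    refine ⟨⟨r, rfl⟩, ?_, e⟩
    rcases hw' with hw' | hw'
    · exact hw'
    · exfalso
      rw [e, mul_one, hw', mul_inv_eq_iff_eq_mul, h.bw.eq, mul_assoc] at hbw
      have := mul_left_cancel hbw
      exact hz (mul_eq_right.1 this)
  · right
    have e : (b ^ (2 ^ (α + 1 + 1))) ^ (2 * r + 1) = b ^ (2 ^ (α + 1 + 1)) := by
      rw [zpow_add, zpow_mul, hz2', one_zpow, one_mul, zpow_one]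
    refine ⟨⟨r, rfl⟩, ?_, e⟩
    rcases hw' with hw' | hw'
    · exfalso
      rw [e, hw', mul_one, mul_inv_cancel, one_mul] at hbw
      exact hz hbw.symm
    · exact hw'

theorem c0inv {G : Type u} [Group G] {a b D : G} (hbD : Commute b D) (haaD : Commute (a * a) D)
    (e : b * (a * a) * b⁻¹ = a * a * D) : b⁻¹ * (a * a)⁻¹ * b = (a * a)⁻¹ * D := by
  have : b * ((a * a)⁻¹ * D) * b⁻¹ = (b * (a * a) * b⁻¹)⁻¹ * (b * D * b⁻¹) := by group
  rw [e, hbD.eq, mul_inv_cancel_right, haaD.eq] at this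
  have h4 : b * ((a * a)⁻¹ * D) * b⁻¹ = (a * a)⁻¹ := by
    rw [this, mul_inv_rev, mul_assoc, inv_mul_cancel, mul_one]
  nth_rewrite 1 [← h4]; group

theorem lem3_reg {G : Type u} [Group G] [Finite G] {a b : G} {β : ℕ} (h : Good a b 2 (β + 1))
    (hr : Reg1 a b) : β = 2 ∧ (b * (a * a) * b⁻¹ = (a * a)⁻¹ * b ^ 4 ∨
      b * (a * a) * b⁻¹ = (a * a)⁻¹ * (b ^ 4)⁻¹) := by
  obtain ⟨D, hD, ⟨h3, haD, e⟩ | ⟨rfl, -, e⟩⟩ := lem3 h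
  · exfalso
    have hz := h.tp.z_ne
    have hz2 := h.tp.z_sq
    obtain ⟨n, hn⟩ : ∃ n : ℤ, D = b ^ n := by
      rcases hD with rfl | rfl
      · exact ⟨(2 ^ β : ℕ), by rw [zpow_natCast]⟩
      · exact ⟨-(2 ^ β : ℕ), by rw [zpow_neg, zpow_natCast]⟩
    have hDD : D * D = b ^ (2 ^ (β + 1)) := by
      have : b ^ (2 ^ β) * b ^ (2 ^ β) = b ^ (2 ^ (β + 1)) := by
        rw [← pow_add, ← two_mul, ← pow_succ']
      rcases hD with rfl | rfl
      · exact this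
      · rw [← mul_inv_rev, this]; exact inv_eq_of_mul_eq_one_left hz2
    have hbD : Commute b D := by rw [hn]; exact (Commute.refl b).zpow_right n
    have haaD : Commute (a * a) D := by
      have := haD.inv_right; rw [inv_inv] at this; exact SemiconjBy.mul_left this haD
    have e1 : b * (a * a) * b⁻¹ = a ^ (2 : ℤ) * b ^ n := by
      rw [e, hn, zpow_ofNat, pow_two]
    have e2 := h.tp.reg1_eq hr e1
    rw [zpow_neg, zpow_neg, ← hn, zpow_ofNat, pow_two] at e2
    have e3 : b⁻¹ * (a * a)⁻¹ * b = (a * a)⁻¹ * D := c0inv hbD haaD e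
    rw [e3] at e2
    have e4 := mul_left_cancel e2
    rw [eq_inv_iff_mul_eq_one, hDD] at e4
    exact hz e4
  · refine ⟨rfl, ?_⟩
    rcases hD with rfl | rfl
    · left; exact e
    · right; exact e

theorem lemD : ∀ (α : ℕ) {G : Type u} [Group G] [Finite G] {a b : G} {β : ℕ},
    Good a b (α + 2) β → Reg1 a b → β = α + 3 ∧ ∃ s : ℤ,
      b * (a * a) * b⁻¹ = (a * a)⁻¹ * (b ^ (2 ^ β)) ^ s * (b ^ 4)⁻¹ := by
  intro α
  induction α with
  | zero =>
    intro G _ _ a b β h hr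
    obtain ⟨β, rfl⟩ : ∃ k, β = k + 1 := ⟨β - 1, by have := h.le; omega⟩
    obtain ⟨rfl, h2⟩ := lem3_reg h hr
    refine ⟨rfl, ?_⟩
    rcases h2 with h2 | h2
    · refine ⟨1, ?_⟩
      rw [h2, zpow_one, mul_assoc]; congr 1
      rw [eq_mul_inv_iff_mul_eq, ← pow_add]; rfl
    · exact ⟨0, by rw [h2, zpow_zero, mul_one]⟩
  | succ α ih =>
    intro G _ _ a b β h hr
    obtain ⟨β, rfl⟩ : ∃ k, β = k + 1 := ⟨β - 1, by have := h.le; omega⟩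
    have h : Good a b (α + 2 + 1) (β + 1) := h
    obtain ⟨N, hN, hm, hq⟩ := h.quotWZ (by omega)
    obtain ⟨hβ, s, hs⟩ := ih hq (hr.map (QuotientGroup.mk' N))
    subst hβ
    refine ⟨rfl, ?_⟩
    have h : Good a b (α + 2 + 1) (α + 2 + 1 + 1) := h
    obtain ⟨w', t, hw', hst⟩ := h.lift hm hs
    obtain ⟨k1, k2, k3, k4, k5⟩ := h.star (by omega) hw' hst
    rcases h.star_even hw' k4 with ⟨⟨r, rfl⟩, rfl, hz⟩ | ⟨⟨r, hr2⟩, rfl, hz⟩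
    · refine ⟨r, ?_⟩
      rw [hst, mul_one, zpow_mul, zpow_ofNat, ← pow_mul, ← pow_succ]
    · exfalso
      have e1 : b * (a * a) * b⁻¹ = a ^ ((-2 : ℤ) + (2 ^ (α + 2 + 1) : ℕ)) *
          b ^ (((2 ^ (α + 2 + 1) : ℕ) : ℤ) * t + -4) := by
        rw [hst, zpow_add, zpow_add, zpow_mul, zpow_natCast, zpow_natCast, mul_assoc]
        rw [zpow_neg, zpow_neg, zpow_ofNat, zpow_ofNat, pow_two]
      have e2 := h.tp.reg1_eq hr e1
      rw [k5] at e2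
      have e3 : a * a * a ^ 2 ^ (α + 2 + 1) * b ^ 4 * (b ^ 2 ^ (α + 2 + 1)) ^ t =
          a ^ ((2 : ℤ) + (2 ^ (α + 2 + 1) : ℕ)) *
          b ^ (4 + ((2 ^ (α + 2 + 1) : ℕ) : ℤ) * t) := by
        rw [zpow_add, zpow_add, zpow_mul, zpow_natCast, zpow_natCast, zpow_ofNat, zpow_ofNat,
          pow_two]
        simp only [mul_assoc]
      rw [e3] at e2
      have e4 := (h.tp.eq_of_eq e2).2
      have : (4 + ((2 ^ (α + 2 + 1) : ℕ) : ℤ) * t) - -(((2 ^ (α + 2 + 1) : ℕ) : ℤ) * t + -4)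
          = ((2 ^ (α + 2 + 1 + 1) : ℕ) : ℤ) * t := by push_cast; ring
      rw [this] at e4
      have e5 := zpow_eq_one_of_dvd_two h.tp.hb e4
      rw [zpow_mul, zpow_natCast, hz] at e5
      exact h.tp.z_ne e5

end six

section seven

universe u

theorem TP.of_rot {G : Type*} [Group G] {a b : G} {α β : ℕ} (h : IsRotPair a b (2 ^ α) (2 ^ β))
    (ht : IsTight a b) : TP a b α β := by
  obtain ⟨-, h1, h2, -, -, h3, h4⟩ := h
  refine ⟨by rw [← pow_two, h3], by rw [← h1, pow_orderOf_eq_one],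
    by rw [← h2, pow_orderOf_eq_one], ?_, ht⟩
  intro i j hij
  have e : a ^ i = b ^ (-j) := by rw [zpow_neg]; exact eq_inv_of_mul_eq_one_left hij
  have hm : a ^ i ∈ Subgroup.zpowers a ⊓ Subgroup.zpowers b :=
    ⟨⟨i, rfl⟩, ⟨-j, e.symm⟩⟩
  rw [h4, Subgroup.mem_bot] at hm
  rw [hm, one_mul] at hij
  have d1 := orderOf_dvd_iff_zpow_eq_one.2 hm
  have d2 := orderOf_dvd_iff_zpow_eq_one.2 hij
  rw [h1] at d1
  rw [h2] at d2
  exact ⟨by exact_mod_cast d1, by exact_mod_cast d2⟩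

theorem TP.isRot {G : Type*} [Group G] {a b : G} {α β : ℕ} (h : TP a b α β) (hα : 1 ≤ α)
    (hβ : 1 ≤ β) : IsRotPair a b (2 ^ α) (2 ^ β) := by
  refine ⟨?_, ?_, ?_, ?_, ?_, by rw [pow_two, h.ab], ?_⟩
  · rw [eq_top_iff]
    intro g _
    obtain ⟨i, j, rfl⟩ := h.tight g
    exact mul_mem (Subgroup.zpow_mem _ (Subgroup.subset_closure (by simp)) _)
      (Subgroup.zpow_mem _ (Subgroup.subset_closure (by simp)) _)
  · apply Nat.dvd_antisymm (orderOf_dvd_of_pow_eq_one h.ha)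
    have := h.a_dvd (j := (orderOf a : ℕ)) (by rw [zpow_natCast, pow_orderOf_eq_one])
    exact_mod_cast this
  · apply Nat.dvd_antisymm (orderOf_dvd_of_pow_eq_one h.hb)
    have := h.b_dvd (j := (orderOf b : ℕ)) (by rw [zpow_natCast, pow_orderOf_eq_one])
    exact_mod_cast this
  · calc 2 = 2 ^ 1 := rfl
      _ ≤ 2 ^ α := Nat.pow_le_pow_right (by norm_num) hα
  · calc 2 = 2 ^ 1 := rfl
      _ ≤ 2 ^ β := Nat.pow_le_pow_right (by norm_num) hβ
  · rw [eq_bot_iff]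
    rintro g ⟨⟨i, hi⟩, ⟨j, hj⟩⟩
    simp only at hi hj
    have := (h.uniq i (-j) (by rw [zpow_neg, hi, hj, mul_inv_cancel])).1
    rw [Subgroup.mem_bot, ← hi]
    exact zpow_eq_one_of_dvd_two h.ha this

theorem TP.equiv {G H : Type*} [Group G] [Group H] {a b : G} {α β : ℕ} (h : TP a b α β)
    (e : G ≃* H) : TP (e a) (e b) α β := by
  refine ⟨?_, ?_, ?_, ?_, ?_⟩
  · rw [← map_mul, ← map_mul, h.ab, map_one]
  · rw [← map_pow, h.ha, map_one]
  · rw [← map_pow, h.hb, map_one]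
  · intro i j hij
    rw [← map_zpow, ← map_zpow, ← map_mul, map_eq_one_iff e e.injective] at hij
    exact h.uniq i j hij
  · intro g
    obtain ⟨i, j, hij⟩ := h.tight (e.symm g)
    exact ⟨i, j, by rw [← map_zpow, ← map_zpow, ← map_mul, ← hij, e.apply_symm_apply]⟩

theorem regular_of_equiv {G H : Type*} [Group G] [Group H] {a b : G} (e : G ≃* H)
    (h : IsOrientablyRegular (e a) (e b)) : IsOrientablyRegular a b := by
  obtain ⟨φ, h1, h2⟩ := h
  exact ⟨(e.trans φ).trans e.symm, by simp [h1], by simp [h2]⟩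

/-- Passing to a quotient in the bottom universe. -/
theorem TP.quot_small {G : Type u} [Group G] [Finite G] {a b : G} {α β : ℕ} {N : Subgroup G}
    [N.Normal] (h : TP (a : G ⧸ N) (b : G ⧸ N) α β) (hα : 1 ≤ α) (hβ : 1 ≤ β) :
    IsOrientablyRegular (a : G ⧸ N) (b : G ⧸ N) ∨
    ∃ (H : Type) (_ : Group H) (_ : Finite H) (a' b' : H), IsRotPair a' b' (2 ^ α) (2 ^ β) ∧
      IsTight a' b' ∧ IsChiral a' b' ∧ Covers a b a' b' := by
  by_cases hr : IsOrientablyRegular (a : G ⧸ N) (b : G ⧸ N)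
  · exact Or.inl hr
  right
  let e : (G ⧸ N) ≃* Shrink.{0} (G ⧸ N) := (Shrink.mulEquiv).symm
  have h2 := h.equiv e
  refine ⟨Shrink.{0} (G ⧸ N), inferInstance, Finite.of_equiv _ e.toEquiv, e a, e b,
    h2.isRot hα hβ, h2.tight, fun h3 => hr (regular_of_equiv e h3),
    e.toMonoidHom.comp (QuotientGroup.mk' N), rfl, rfl⟩

theorem mirror_mod {G : Type u} [Group G] {a b : G} {N : Subgroup G} [N.Normal]
    (h : IsOrientablyRegular (a : G ⧸ N) (b : G ⧸ N)) {k i j : ℤ}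
    (e : b * (a * a) ^ k * b⁻¹ = a ^ i * b ^ j) :
    ∃ n ∈ N, b⁻¹ * ((a * a) ^ k)⁻¹ * b = a ^ (-i) * b ^ (-j) * n := by
  apply mk_eq_imp
  obtain ⟨φ, h1, h2⟩ := h
  have e2 := congrArg (fun g : G => φ (g : G ⧸ N)) e
  have e3 : φ ((b : G ⧸ N) * (a * a) ^ k * (b : G ⧸ N)⁻¹) = φ ((a : G ⧸ N) ^ i * (b : G ⧸ N) ^ j) :=
    e2
  simp only [map_mul, map_inv, map_zpow, h1, h2] at e3
  show (b : G ⧸ N)⁻¹ * (((a : G ⧸ N) * a) ^ k)⁻¹ * b = (a : G ⧸ N) ^ (-i) * (b : G ⧸ N) ^ (-j)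
  rw [zpow_neg, zpow_neg, ← inv_zpow, ← inv_zpow, ← inv_zpow, mul_inv_rev]
  rw [inv_inv] at e3
  exact e3

theorem TP.final {G : Type*} [Group G] {a b : G} {α β : ℕ} (h : TP a b α β) :
    b⁻¹ * a = a * (b * (a * a) * b⁻¹) * b ∧ b * a⁻¹ = a⁻¹ * (b⁻¹ * (a * a)⁻¹ * b) * b⁻¹ := by
  have h1 : b⁻¹ = a * b * a := by
    have := h.swap.ba
    rw [this, inv_mul_cancel_right]
  have h2 : b = a⁻¹ * b⁻¹ * a⁻¹ := by
    rw [← h.ba, mul_inv_cancel_right]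
  constructor
  · have : a * (b * (a * a) * b⁻¹) * b = a * b * a * a := by group
    rw [this, ← h1]
  · have : a⁻¹ * (b⁻¹ * (a * a)⁻¹ * b) * b⁻¹ = a⁻¹ * b⁻¹ * a⁻¹ * a⁻¹ := by group
    rw [this, ← h2]

theorem main_aux {G : Type u} [Group G] [Finite G] {a b : G} {A B : ℕ}
    (h : TP a b (A + 1) (B + 1)) (hAB : A < B) (hch : ¬ IsOrientablyRegular a b)
    (hZ : ∀ {N : Subgroup G} [N.Normal], TP (a : G ⧸ N) (b : G ⧸ N) (A + 1) B →
      IsOrientablyRegular (a : G ⧸ N) (b : G ⧸ N))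
    (hW : 1 ≤ A → ∀ {N : Subgroup G} [N.Normal], TP (a : G ⧸ N) (b : G ⧸ N) A (B + 1) →
      IsOrientablyRegular (a : G ⧸ N) (b : G ⧸ N)) :
    (A = 2 ∧ 4 ≤ B ∧ ∃ ε : ℤ, (ε = 1 ∨ ε = -1) ∧
      b * (a * a) * b⁻¹ = a * a * b ^ (ε * 2 ^ (B - 1)) ∧
      b⁻¹ * (a * a)⁻¹ * b = (a * a)⁻¹ * b ^ (ε * 2 ^ (B - 1))) ∨
    (3 ≤ A ∧ B = A + 1 ∧ ∃ ε : ℤ, (ε = 1 ∨ ε = -1) ∧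
      b * (a * a) * b⁻¹ = (a * a)⁻¹ * a ^ (2 ^ A) * b ^ (ε * 2 ^ A) * (b ^ 4)⁻¹ ∧
      b⁻¹ * (a * a)⁻¹ * b = a * a * a ^ (2 ^ A) * b ^ 4 * b ^ (ε * 2 ^ A)) := by
  have hmz : ∀ {k i j : ℤ}, b * (a * a) ^ k * b⁻¹ = a ^ i * b ^ j →
      ∃ n, (n = 1 ∨ n = b ^ (2 ^ B)) ∧ b⁻¹ * ((a * a) ^ k)⁻¹ * b = a ^ (-i) * b ^ (-j) * n := by
    obtain ⟨N, hN, hm, hq⟩ := h.quotZ (by omega)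
    intro k i j e
    obtain ⟨n, hn, e2⟩ := mirror_mod (hZ hq) e
    exact ⟨n, hm n hn, e2⟩
  have haa : Commute a (a * a) := (Commute.refl a).mul_right (Commute.refl a)
  rcases Nat.eq_zero_or_pos A with rfl | hA
  · exfalso
    have ha2 : a * a = 1 := by have := h.ha; simpa [pow_two] using this
    exact hch (h.regular1 (i := 0) (j := 0) (by simp [ha2]) (by simp [ha2]) (by simp))
  have hgood : Good a b A B := by
    refine ⟨h, hA, hAB, ?_⟩
    rcases lemA B h hA hAB.le with hc | hc
    · exfalso
      obtain ⟨N, hN, hm, hq⟩ := h.quotW hc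
      have hreg := hW hA hq
      apply hch
      apply h.regular
      intro k
      obtain ⟨i, j, e⟩ := h.tight (b * (a * a) ^ k * b⁻¹)
      refine ⟨i, j, e, ?_⟩
      obtain ⟨n1, hn1, e1⟩ := hmz e
      obtain ⟨n2, hn2, e2⟩ := mirror_mod hreg e
      have : n1 = n2 := by rw [e1] at e2; exact mul_left_cancel e2
      subst this
      have : n1 = 1 := by
        rcases hn1 with hn1 | hn1
        · exact hn1
        rcases hm n1 hn2 with hn3 | hn3
        · exact hn3
        exfalso
        have e4 : a ^ ((2 ^ A : ℕ) : ℤ) * b ^ (-((2 ^ B : ℕ) : ℤ)) = 1 := by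
          rw [zpow_neg, zpow_natCast, zpow_natCast, ← hn1, ← hn3, mul_inv_cancel]
        have := (h.uniq _ _ e4).1
        have h6 := zpow_eq_one_of_dvd_two h.ha this
        rw [zpow_natCast] at h6
        exact h.swap.z_ne h6
      rw [e1, this, mul_one]
    · exact mul_inv_eq_iff_eq_mul.1 hc
  have hz2 := h.z_sq
  have hzi : (b ^ (2 ^ B))⁻¹ = b ^ (2 ^ B) := inv_eq_of_mul_eq_one_left hz2
  have hcz : Commute a (b ^ (2 ^ B)) := h.core (by omega)
  obtain rfl | rfl | hA3 : A = 1 ∨ A = 2 ∨ 3 ≤ A := by omega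
  · exfalso
    have e : b * (a * a) * b⁻¹ = a * a * b ^ (2 ^ B) := by
      have := hgood.bw
      rw [pow_one, pow_two] at this
      exact mul_inv_eq_iff_eq_mul.2 this
    have hbz : Commute b (b ^ (2 ^ B)) := (Commute.refl b).pow_right _
    have e2 := c0inv hbz (hcz.mul_left hcz) e
    refine hch (h.regular1 (i := 2) (j := (2 ^ B : ℕ)) ?_ ?_ ?_)
    · rw [e, zpow_ofNat, zpow_natCast, pow_two]
    · rw [e2, zpow_neg, zpow_neg, zpow_ofNat, zpow_natCast, pow_two, hzi]
    · rw [zpow_natCast]; exact hcz.zpow_left _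
  · left
    obtain ⟨B, rfl⟩ : ∃ k, B = k + 1 := ⟨B - 1, by omega⟩
    obtain ⟨D, hD, h3⟩ := lem3 hgood
    obtain ⟨ε, hε, hn⟩ : ∃ ε : ℤ, (ε = 1 ∨ ε = -1) ∧ D = b ^ (ε * 2 ^ B) := by
      rcases hD with rfl | rfl
      · exact ⟨1, Or.inl rfl, by rw [one_mul]; exact_mod_cast (zpow_natCast b (2 ^ B)).symm⟩
      · refine ⟨-1, Or.inr rfl, ?_⟩
        rw [neg_one_mul, zpow_neg, inv_inj]
        exact_mod_cast (zpow_natCast b (2 ^ B)).symm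
    have hbD : Commute b D := by rw [hn]; exact (Commute.refl b).zpow_right _
    rcases h3 with ⟨h3, haD, e⟩ | ⟨rfl, haD, e⟩
    · have haaD : Commute (a * a) D := by
        have := haD.inv_right; rw [inv_inv] at this; exact SemiconjBy.mul_left this haD
      refine ⟨rfl, by omega, ε, hε, ?_, ?_⟩
      · rw [e, hn]; rfl
      · rw [c0inv hbD haaD e, hn]; rfl
    · exfalso
      refine hch (h.regular1 (i := -2) (j := ε * 2 ^ 2) ?_ ?_ ?_)
      · rw [e, hn, zpow_neg, zpow_ofNat a, pow_two a]
      · rw [neg_neg, zpow_neg, ← hn, zpow_ofNat, pow_two]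
        have : b * (a * a * D⁻¹) * b⁻¹ = (a * a)⁻¹ := by
          have h5 : b * (a * a * D⁻¹) * b⁻¹ = (b * (a * a) * b⁻¹) * (b * D * b⁻¹)⁻¹ := by group
          rw [h5, e, hbD.eq, mul_inv_cancel_right, mul_inv_cancel_right]
        rw [← this]; group
      · rw [← hn]; exact haD.zpow_left _
  · right
    obtain ⟨α, rfl⟩ : ∃ k, A = k + 2 + 1 := ⟨A - 3, by omega⟩
    obtain ⟨B, rfl⟩ : ∃ k, B = k + 1 := ⟨B - 1, by omega⟩
    obtain ⟨N, hN, hm, hq⟩ := hgood.quotWZ (by omega)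
    have hr1 : Reg1 (a : G ⧸ N) (b : G ⧸ N) := by
      obtain ⟨i, j, e⟩ := h.tight (b * (a * a) ^ (1 : ℤ) * b⁻¹)
      obtain ⟨n, hn, e2⟩ := hmz e
      rw [zpow_one] at e e2
      have hn1 : (n : G ⧸ N) = 1 := by
        rcases hn with rfl | rfl
        · rfl
        · exact hq.tp.hb
      refine ⟨i, j, ?_, ?_⟩
      · exact congrArg (fun g : G => (g : G ⧸ N)) e
      · have e3 := congrArg (fun g : G => (g : G ⧸ N)) e2
        simp only [QuotientGroup.mk_mul _ (_ * _) n, hn1, mul_one] at e3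
        exact e3
    obtain ⟨rfl, s, hs⟩ := lemD α hq hr1
    have hgood : Good a b (α + 2 + 1) (α + 2 + 1 + 1) := hgood
    obtain ⟨w', t, hw', hst⟩ := hgood.lift hm hs
    obtain ⟨k1, k2, k3, k4, k5⟩ := hgood.star (by omega) hw' hst
    refine ⟨by omega, rfl, ?_⟩
    rcases hgood.star_even hw' k4 with ⟨⟨r, hr⟩, rfl, hz⟩ | ⟨⟨r, hr⟩, rfl, hz⟩
    · exfalso
      rw [hz, mul_one] at k3
      have hDD : ((b ^ (2 ^ (α + 2 + 1))) ^ t)⁻¹ = (b ^ (2 ^ (α + 2 + 1))) ^ t := by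
        apply inv_eq_of_mul_eq_one_left
        rw [← (Commute.refl _).mul_zpow, ← pow_add, ← two_mul, ← pow_succ', hz]
      refine hch (h.regular1 (i := -2) (j := (2 ^ (α + 2 + 1) : ℕ) * t + -4) ?_ ?_ ?_)
      · rw [hst, mul_one, zpow_add, zpow_mul, zpow_neg, zpow_neg, zpow_natCast, zpow_ofNat,
          zpow_ofNat, pow_two, mul_assoc]
      · rw [k5, mul_one, neg_add, neg_neg, neg_neg, add_comm _ (4 : ℤ), zpow_add, zpow_neg, zpow_mul,
          zpow_natCast, zpow_ofNat, zpow_ofNat, pow_two, hDD, mul_assoc]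
      · rw [zpow_add, zpow_mul, zpow_natCast, zpow_neg b, zpow_ofNat]
        exact (k1.mul_right (Commute.inv_right k3)).zpow_left _
    · have hd4 : (b ^ (2 ^ (α + 2 + 1))) ^ (4 : ℤ) = 1 := by
        rw [zpow_ofNat, ← pow_mul, ← h.hb]; congr 1; ring
      obtain ⟨ε, hε, hn⟩ : ∃ ε : ℤ, (ε = 1 ∨ ε = -1) ∧
          (b ^ (2 ^ (α + 2 + 1))) ^ t = b ^ (ε * 2 ^ (α + 2 + 1)) := by
        have key : ∀ ε : ℤ, b ^ (ε * 2 ^ (α + 2 + 1)) = (b ^ (2 ^ (α + 2 + 1))) ^ ε := by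
          intro ε
          rw [mul_comm, zpow_mul]
          congr 1
          exact_mod_cast zpow_natCast b (2 ^ (α + 2 + 1))
        rcases Int.even_or_odd' r with ⟨q, rfl | rfl⟩
        · refine ⟨1, Or.inl rfl, ?_⟩
          have : t = 4 * q + 1 := by omega
          rw [key, this, zpow_add, zpow_mul, hd4, one_zpow, one_mul]
        · refine ⟨-1, Or.inr rfl, ?_⟩
          have : t = 4 * (q + 1) + -1 := by omega
          rw [key, this, zpow_add, zpow_mul, hd4, one_zpow, one_mul]
      rw [hn] at hst k5
      exact ⟨ε, hε, hst, k5⟩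

end seven

theorem atomic_power_of_two_structure {G : Type*} [Group G] [Finite G] (a b : G)
    (α β : ℕ) (hα : 1 ≤ α) (hαβ : α < β)
    (h : IsAtomicPair a b (2 ^ α) (2 ^ β)) :
    5 ≤ β ∧
    Xor'
      (α = 3 ∧ ∃ ε : ℤ, (ε = 1 ∨ ε = -1) ∧
        b⁻¹ * a = a ^ (3 : ℤ) * b ^ (1 + ε * 2 ^ (β - 2)) ∧
        b * a⁻¹ = a ^ (-3 : ℤ) * b ^ (-1 + ε * 2 ^ (β - 2)))
      (4 ≤ α ∧ β = α + 1 ∧ ∃ ε : ℤ, (ε = 1 ∨ ε = -1) ∧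
        b⁻¹ * a = a ^ (-1 + 2 ^ (α - 1) : ℤ) * b ^ (-3 + ε * 2 ^ (α - 1)) ∧
        b * a⁻¹ = a ^ (1 + 2 ^ (α - 1) : ℤ) * b ^ (3 + ε * 2 ^ (α - 1))) := by
  obtain ⟨hrot, htight, hch, hat1, hat2⟩ := h
  obtain ⟨A, rfl⟩ : ∃ k, α = k + 1 := ⟨α - 1, by omega⟩
  obtain ⟨B, rfl⟩ : ∃ k, β = k + 1 := ⟨β - 1, by omega⟩
  have htp := TP.of_rot hrot htight
  have hmain := main_aux htp (by omega) hch
    (by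
      intro N hN hq
      rcases hq.quot_small (by omega) (by omega) with h1 | ⟨H, i1, i2, a', b', h1, h2, h3, h4⟩
      · exact h1
      · exact absurd h4 (hat2 H i1 i2 a' b' _ (Nat.pow_lt_pow_right (by norm_num) (by omega))
          h1 h2 h3))
    (by
      intro hA N hN hq
      rcases hq.quot_small (by omega) (by omega) with h1 | ⟨H, i1, i2, a', b', h1, h2, h3, h4⟩
      · exact h1
      · exact absurd h4 (hat1 H i1 i2 a' b' _ (Nat.pow_lt_pow_right (by norm_num) (by omega))
          h1 h2 h3))
  obtain ⟨f1, f2⟩ := htp.final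
  rcases hmain with ⟨rfl, hB, ε, hε, e1, e2⟩ | ⟨hA, rfl, ε, hε, e1, e2⟩
  · refine ⟨by omega, Or.inl ⟨⟨rfl, ε, hε, ?_, ?_⟩, fun h => by omega⟩⟩
    · have : B + 1 - 2 = B - 1 := by omega
      rw [f1, e1, this, add_comm (1 : ℤ), zpow_add, zpow_one, zpow_ofNat a]
      simp only [pow_succ, pow_zero, one_mul, mul_assoc]
    · have : B + 1 - 2 = B - 1 := by omega
      rw [f2, e2, this, add_comm (-1 : ℤ), zpow_add, zpow_neg_one, zpow_neg, zpow_ofNat a]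
      simp only [pow_succ, pow_zero, one_mul, mul_assoc, mul_inv_rev]
  · refine ⟨by omega, Or.inr ⟨⟨by omega, rfl, ε, hε, ?_, ?_⟩, fun h => by omega⟩⟩
    · have ea : a ^ (-1 + 2 ^ A : ℤ) = a * ((a * a)⁻¹ * a ^ (2 ^ A)) := by
        rw [zpow_add, zpow_neg_one, ← mul_assoc a, mul_inv_rev, mul_inv_cancel_left]
        congr 1
        exact_mod_cast zpow_natCast a (2 ^ A)
      have eb : b ^ (-3 + ε * 2 ^ A) = b ^ (ε * 2 ^ A) * (b ^ 4)⁻¹ * b := by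
        rw [add_comm, zpow_add, mul_assoc]; congr 1
        rw [zpow_neg, zpow_ofNat, eq_inv_mul_iff_mul_eq, pow_succ' b 3, mul_inv_cancel_right]
      rw [f1, e1, Nat.add_sub_cancel, ea, eb]
      simp only [mul_assoc]
    · have ea : a ^ (1 + 2 ^ A : ℤ) = a⁻¹ * (a * a * a ^ (2 ^ A)) := by
        rw [zpow_add, zpow_one, ← mul_assoc a⁻¹, inv_mul_cancel_left]
        congr 1
        exact_mod_cast zpow_natCast a (2 ^ A)
      have eb : b ^ (3 + ε * 2 ^ A) = b ^ 4 * b ^ (ε * 2 ^ A) * b⁻¹ := by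
        rw [← zpow_natCast b 4, ← zpow_add, ← zpow_neg_one, ← zpow_add]
        congr 1; push_cast; ring
      rw [f2, e2, Nat.add_sub_cancel, ea, eb]
      simp only [mul_assoc]
end

section
/- Let (G, a, b) be an atomic chiral rotation pair of type (p, q) with q > p, and let q' be a divisor of q such that the normal core of Subgroup.zpowers b in G equals Subgroup.zpowers (b^q'). Then p is even, and there exist integers i, k, c such that c² ≡ 1 (mod q/q'), c ≢ 1 (mod q/q'), and in G the relations b⁻¹ * a = a^i * b^(1 + k·q') and b * a⁻¹ = a^(−i) * b^(−1 − c·k·q') hold. -/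
structure TP_s5 {H : Type*} [Group H] (a b : H) : Prop where
  gen : Subgroup.closure ({a, b} : Set H) = ⊤
  w : a * b * (a * b) = 1
  inf : ∀ x ∈ Subgroup.zpowers a, x ∈ Subgroup.zpowers b → x = 1
  tight : ∀ g : H, ∃ i j : ℤ, g = a ^ i * b ^ j

def Reg {H : Type*} [Group H] (a b : H) : Prop :=
  ∃ f : H →* H, f a = a⁻¹ ∧ f b = b⁻¹

theorem TP_s5.swap {H : Type*} [Group H] {a b : H} (h : TP_s5 a b) : TP_s5 b a where
  gen := by rw [Set.pair_comm]; exact h.gen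
  w := by
    have := h.w
    calc b * a * (b * a) = a⁻¹ * (a * b * (a * b)) * a := by group
      _ = 1 := by rw [this]; group
  inf := fun x hx hy => h.inf x hy hx
  tight := fun g => by
    obtain ⟨i, j, e⟩ := h.tight g⁻¹
    exact ⟨-j, -i, by rw [← inv_inv g, e]; group⟩

theorem zcomm {H : Type*} [Group H] {a x y : H} (hx : x ∈ Subgroup.zpowers a)
    (hy : y ∈ Subgroup.zpowers a) : x * y = y * x := by
  obtain ⟨i, rfl⟩ := hx
  obtain ⟨j, rfl⟩ := hy
  exact (Commute.zpow_zpow_self a i j).eq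

theorem TP_s5.flip {H : Type*} [Group H] {a b : H} (h : TP_s5 a b) {x : H}
    (hx : x * a = a * x) (hx' : b⁻¹ * x * b * a = a * (b⁻¹ * x * b)) :
    b⁻¹ * (b⁻¹ * x * b) * b = x := by
  have e1 : b⁻¹ * x * b = (a * b)⁻¹ * x * (a * b) := by
    calc b⁻¹ * x * b = b⁻¹ * a⁻¹ * (a * x) * b := by group
      _ = _ := by rw [← hx]; group
  have e2 : b⁻¹ * (b⁻¹ * x * b) * b = (a * b)⁻¹ * (b⁻¹ * x * b) * (a * b) := by
    calc b⁻¹ * (b⁻¹ * x * b) * b = b⁻¹ * a⁻¹ * (a * (b⁻¹ * x * b)) * b := by group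
      _ = _ := by rw [← hx']; group
  rw [e2, e1]
  calc (a * b)⁻¹ * ((a * b)⁻¹ * x * (a * b)) * (a * b)
      = (a * b * (a * b))⁻¹ * x * (a * b * (a * b)) := by group
    _ = x := by rw [h.w]; group

theorem TP_s5.core_mem {H : Type*} [Group H] {a b : H} (h : TP_s5 a b) {x : H}
    (hx : x ∈ Subgroup.zpowers a) (hx' : b⁻¹ * x * b ∈ Subgroup.zpowers a) :
    x ∈ (Subgroup.zpowers a).normalCore := by
  have ha := Subgroup.mem_zpowers a
  have key : ∀ g : H, ∀ x : H, (x ∈ Subgroup.zpowers a ∧ b⁻¹ * x * b ∈ Subgroup.zpowers a) →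
      (g * x * g⁻¹ ∈ Subgroup.zpowers a ∧ b⁻¹ * (g * x * g⁻¹) * b ∈ Subgroup.zpowers a) ∧
      (g⁻¹ * x * g ∈ Subgroup.zpowers a ∧ b⁻¹ * (g⁻¹ * x * g) * b ∈ Subgroup.zpowers a) := by
    intro g
    have hg : g ∈ Subgroup.closure ({a, b} : Set H) := by rw [h.gen]; trivial
    induction hg using Subgroup.closure_induction with
    | mem g hg =>
      rintro x ⟨h1, h2⟩
      rcases hg with rfl | hg
      · have e : g * x = x * g := zcomm ha h1
        have e1 : g * x * g⁻¹ = x := by rw [e]; group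
        have e2 : g⁻¹ * x * g = x := by rw [mul_assoc, ← e]; group
        rw [e1, e2]
        exact ⟨⟨h1, h2⟩, ⟨h1, h2⟩⟩
      · rw [Set.mem_singleton_iff] at hg
        subst hg
        have e := h.flip (zcomm h1 ha) (zcomm h2 ha)
        have e1 : g * x * g⁻¹ = g⁻¹ * x * g := by
          nth_rw 1 [← e]; group
        rw [e1, e]
        exact ⟨⟨h2, h1⟩, ⟨h2, h1⟩⟩
    | one => rintro x hx; simpa using hx
    | mul g k _ _ hg hk =>
      rintro x hx
      have e1 : g * k * x * (g * k)⁻¹ = g * (k * x * k⁻¹) * g⁻¹ := by group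
      have e2 : (g * k)⁻¹ * x * (g * k) = k⁻¹ * (g⁻¹ * x * g) * k := by group
      rw [e1, e2]
      exact ⟨(hg _ (hk x hx).1).1, (hk _ (hg x hx).2).2⟩
    | inv g _ hg =>
      rintro x hx
      rw [inv_inv]
      exact ⟨(hg x hx).2, (hg x hx).1⟩
  intro g
  exact (key g x ⟨hx, hx'⟩).1.1

/-- counting -/
theorem TP_s5.count {H : Type*} [Group H] [Finite H] {a b : H} (h : TP_s5 a b)
    (hc : Nat.card (Subgroup.zpowers b) ≤ Nat.card (Subgroup.zpowers a))
    (hM : ∀ x ∈ Subgroup.zpowers a, b⁻¹ * x * b ∈ Subgroup.zpowers a → x = 1) :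
    b ∈ Subgroup.zpowers a := by
  let f : Subgroup.zpowers a × Subgroup.zpowers a → H := fun z => z.1 * (b⁻¹ * z.2 * b)
  have hf : Function.Injective f := by
    rintro ⟨x, y⟩ ⟨x', y'⟩ e
    simp only [f] at e
    have e1 : b⁻¹ * ((y : H) * (y' : H)⁻¹) * b = (x : H)⁻¹ * x' := by
      calc b⁻¹ * ((y : H) * (y' : H)⁻¹) * b
          = (x : H)⁻¹ * (x * (b⁻¹ * y * b)) * (b⁻¹ * (y' : H) * b)⁻¹ := by group
        _ = _ := by rw [e]; group
    have e2 := hM (y * (y' : H)⁻¹) (mul_mem y.2 (inv_mem y'.2))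
      (by rw [e1]; exact mul_mem (inv_mem x.2) x'.2)
    have e3 : (y : H) = y' := mul_inv_eq_one.1 e2
    rw [e2] at e1
    have e4 : (x : H) = x' := by
      have : (x : H)⁻¹ * x' = 1 := by rw [← e1]; group
      exact inv_mul_eq_one.1 this
    exact Prod.ext (Subtype.ext e4) (Subtype.ext e3)
  let g : Subgroup.zpowers a × Subgroup.zpowers b → H := fun z => z.1 * z.2
  have hg : Function.Surjective g := by
    intro k
    obtain ⟨i, j, e⟩ := h.tight k
    exact ⟨⟨⟨a ^ i, ⟨i, rfl⟩⟩, ⟨b ^ j, ⟨j, rfl⟩⟩⟩, e.symm⟩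
  have c1 := Nat.card_le_card_of_surjective g hg
  have c2 : Nat.card H ≤ Nat.card (Subgroup.zpowers a × Subgroup.zpowers a) := by
    rw [Nat.card_prod] at c1 ⊢
    exact c1.trans (Nat.mul_le_mul_left _ hc)
  have hbij := (Nat.bijective_iff_injective_and_card f).2
    ⟨hf, le_antisymm (Nat.card_le_card_of_injective f hf) c2⟩
  obtain ⟨⟨x, y⟩, e⟩ := hbij.2 b
  simp only [f] at e
  have : b = y * x := by
    have e1 : (x : H) * (b⁻¹ * y) = 1 := by
      calc (x : H) * (b⁻¹ * y) = (x * (b⁻¹ * y * b)) * b⁻¹ := by group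
        _ = 1 := by rw [e]; group
    have e2 : (x : H)⁻¹ = b⁻¹ * y := (eq_inv_of_mul_eq_one_right e1).symm
    calc b = (b⁻¹ * y * (y : H)⁻¹)⁻¹ := by group
      _ = _ := by rw [← e2]; group
  rw [this]
  exact mul_mem y.2 x.2

theorem TP_s5.quot {H : Type*} [Group H] {a b : H} (h : TP_s5 a b) (T : Subgroup H) [T.Normal]
    (hT : ∀ i j : ℤ, (a ^ i)⁻¹ * b ^ j ∈ T → a ^ i ∈ T) :
    TP_s5 (a : H ⧸ T) (b : H ⧸ T) where
  gen := by
    have := congrArg (Subgroup.map (QuotientGroup.mk' T)) h.gen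
    rw [MonoidHom.map_closure, Set.image_pair, ← MonoidHom.range_eq_map,
      QuotientGroup.range_mk'] at this
    exact this
  w := by
    have := congrArg (QuotientGroup.mk' T) h.w
    simpa using this
  inf := by
    rintro x ⟨i, rfl⟩ ⟨j, hj⟩
    simp only at hj ⊢
    rw [← QuotientGroup.mk_zpow, ← QuotientGroup.mk_zpow] at hj
    have := hT i j (QuotientGroup.eq.1 hj.symm)
    rw [← QuotientGroup.mk_zpow]
    exact (QuotientGroup.eq_one_iff _).2 this
  tight := by
    intro g
    obtain ⟨g, rfl⟩ := QuotientGroup.mk_surjective g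
    obtain ⟨i, j, e⟩ := h.tight g
    exact ⟨i, j, by rw [e]; simp⟩

theorem quot_core {H : Type*} [Group H] (b : H) (K : Subgroup H) (hb : b ∈ K) :
    (Subgroup.zpowers (b : H ⧸ K.normalCore)).normalCore = ⊥ := by
  rw [eq_bot_iff]
  intro x hx
  obtain ⟨x, rfl⟩ := QuotientGroup.mk_surjective x
  let C := (Subgroup.zpowers (b : H ⧸ K.normalCore)).normalCore.comap
    (QuotientGroup.mk' K.normalCore)
  have hC : C ≤ K.normalCore := by
    rw [Subgroup.normal_le_normalCore]
    intro y hy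
    have hy' := Subgroup.normalCore_le _ (Subgroup.mem_comap.1 hy)
    obtain ⟨j, hj⟩ := hy'
    simp only at hj
    rw [← QuotientGroup.mk_zpow] at hj
    have := Subgroup.normalCore_le _ (QuotientGroup.eq.1 hj)
    have h2 := mul_mem (zpow_mem hb j) this
    simpa using h2
  have : x ∈ C := hx
  exact (QuotientGroup.eq_one_iff _).2 (hC this)

theorem reg_surj {H : Type*} [Group H] {a b : H} (h : TP_s5 a b) {f : H →* H}
    (fa : f a = a⁻¹) (fb : f b = b⁻¹) : Function.Surjective f := by
  rw [← MonoidHom.range_eq_top, eq_top_iff, ← h.gen, Subgroup.closure_le]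
  rintro x (rfl | hx)
  · exact ⟨x⁻¹, by rw [map_inv, fa, inv_inv]⟩
  · rw [Set.mem_singleton_iff] at hx
    subst hx
    exact ⟨x⁻¹, by rw [map_inv, fb, inv_inv]⟩

theorem reg_core {H : Type*} [Group H] {f : H →* H} (hf : Function.Surjective f)
    {K : Subgroup H} (hK : ∀ x ∈ K, f x ∈ K) {x : H} (hx : x ∈ K.normalCore) :
    f x ∈ K.normalCore := by
  have hn : (K.normalCore.map f).Normal := Subgroup.Normal.map inferInstance f hf
  have : K.normalCore.map f ≤ K.normalCore := by
    rw [Subgroup.normal_le_normalCore]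
    rintro _ ⟨y, hy, rfl⟩
    exact hK _ (Subgroup.normalCore_le _ hy)
  exact this ⟨x, hx, rfl⟩
theorem f_inv {H : Type*} [Group H] {a x : H} {f : H →* H}
    (fa : f a = a⁻¹) (hx : x ∈ Subgroup.zpowers a) : f x = x⁻¹ := by
  obtain ⟨i, rfl⟩ := hx
  simp [map_zpow, fa]

theorem lemD_s5 {H : Type*} [Group H] {a b : H} (h : TP_s5 a b) {f : H →* H}
    (fa : f a = a⁻¹) (fb : f b = b⁻¹) (M T : Subgroup H) [hMn : M.Normal] [hTn : T.Normal]
    (hMA : M ≤ Subgroup.zpowers a)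
    (hT : ∀ t ∈ T, ∃ g ∈ Subgroup.zpowers b, ∃ μ ∈ M, g ∈ T ∧ t = g * μ)
    (hB : ∀ g ∈ Subgroup.zpowers b, a⁻¹ * g * a ∈ Subgroup.zpowers b → g = 1)
    {g : H} (gB : g ∈ Subgroup.zpowers b) (gT : g ∈ T) (gM : ∀ ν ∈ M, Commute g ν) :
    ∃ μ ∈ M, Commute b μ ∧ a⁻¹ * g * a = g⁻¹ * μ ∧ Commute g (a * a) := by
  have ha := Subgroup.mem_zpowers a
  have hb := Subgroup.mem_zpowers b
  have aM : ∀ ν ∈ M, Commute a ν := fun ν hν => zcomm ha (hMA hν)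
  have MM : ∀ μ ∈ M, ∀ ν ∈ M, Commute μ ν := fun μ hμ ν hν => zcomm (hMA hμ) (hMA hν)
  have conjM : ∀ g : H, (∀ ν ∈ M, Commute g ν) → ∀ g₁ μ, μ ∈ M → a⁻¹ * g * a = g₁ * μ →
      ∀ ν ∈ M, Commute g₁ ν := by
    intro g gM g₁ μ hμ e ν hν
    have : g₁ = a⁻¹ * g * a * μ⁻¹ := by rw [e]; group
    rw [this]
    exact ((((aM ν hν).inv_left).mul_left (gM ν hν)).mul_left (aM ν hν)).mul_left
      ((MM μ hμ ν hν).inv_left)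
  have tconj : ∀ g ∈ T, a⁻¹ * g * a ∈ T := by
    intro g hg
    have := hTn.conj_mem g hg a⁻¹
    rwa [inv_inv] at this
  obtain ⟨g₁, g₁B, μ, hμ, g₁T, e1⟩ := hT _ (tconj g gT)
  have g₁M := conjM g gM g₁ μ hμ e1
  have e1' : a * g * a⁻¹ = g₁ * μ := by
    have e2 := congrArg f e1
    rw [map_mul, map_mul, map_inv, map_mul, fa, f_inv fb gB, f_inv fb g₁B,
      f_inv fa (hMA hμ)] at e2
    calc a * g * a⁻¹ = (a⁻¹⁻¹ * g⁻¹ * a⁻¹)⁻¹ := by group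
      _ = (g₁⁻¹ * μ⁻¹)⁻¹ := by rw [e2]
      _ = μ * g₁ := by group
      _ = g₁ * μ := (g₁M μ hμ).eq.symm
  have ga2 : Commute g (a * a) := by
    show g * (a * a) = (a * a) * g
    calc g * (a * a) = a * (a⁻¹ * g * a) * a := by group
      _ = a * (a * g * a⁻¹) * a := by rw [e1, e1']
      _ = (a * a) * g := by group
  obtain ⟨g₂, g₂B, μ₂, hμ₂, g₂T, e2⟩ := hT _ (tconj g₁ g₁T)
  have e3 : g₂ * μ₂ * μ = g := by
    have am : a⁻¹ * μ * a = μ := by rw [mul_assoc, ← (aM μ hμ).eq]; group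
    calc g₂ * μ₂ * μ = (a⁻¹ * g₁ * a) * (a⁻¹ * μ * a) := by rw [e2, am]
      _ = a⁻¹ * (g₁ * μ) * a := by group
      _ = a⁻¹ * (a * g * a⁻¹) * a := by rw [e1']
      _ = g := by group
  have e4 : μ₂ * μ = 1 := by
    apply h.inf _ (mul_mem (hMA hμ₂) (hMA hμ))
    have : μ₂ * μ = g₂⁻¹ * g := by rw [← e3]; group
    rw [this]
    exact mul_mem (inv_mem g₂B) gB
  have e5 : g₂ = g := by rw [← e3, mul_assoc, e4, mul_one]
  have e6 : μ₂ = μ⁻¹ := eq_inv_of_mul_eq_one_left e4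
  rw [e5, e6] at e2
  have hμ'0 : b⁻¹ * μ * b ∈ M := by
    have := hMn.conj_mem μ hμ b⁻¹
    rwa [inv_inv] at this
  have fl := h.flip (aM μ hμ).eq.symm (aM _ hμ'0).eq.symm
  obtain ⟨μ', hμ', eμ'⟩ : ∃ μ' ∈ M, μ' = b⁻¹ * μ * b := ⟨_, hμ'0, rfl⟩
  rw [← eμ'] at fl
  have bg : ∀ g ∈ Subgroup.zpowers b, b⁻¹ * g * b = g := by
    intro g hg
    rw [mul_assoc, zcomm hg hb]; group
  have am' : a⁻¹ * μ' * a = μ' := by rw [mul_assoc, ← (aM μ' hμ').eq]; group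
  have e7 : (a * b)⁻¹ * g * (a * b) = g₁ * μ' := by
    calc (a * b)⁻¹ * g * (a * b) = b⁻¹ * (a⁻¹ * g * a) * b := by group
      _ = (b⁻¹ * g₁ * b) * (b⁻¹ * μ * b) := by rw [e1]; group
      _ = g₁ * μ' := by rw [bg g₁ g₁B, ← eμ']
  have e8 : g * (μ'⁻¹ * μ) = g := by
    calc g * (μ'⁻¹ * μ) = (b⁻¹ * g * b) * ((b⁻¹ * μ * b)⁻¹ * (b⁻¹ * μ' * b)) := by
            rw [bg g gB, ← eμ', fl]
      _ = b⁻¹ * (g * μ⁻¹ * μ') * b := by group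
      _ = b⁻¹ * ((a⁻¹ * g₁ * a) * (a⁻¹ * μ' * a)) * b := by rw [e2, am']
      _ = (a * b)⁻¹ * (g₁ * μ') * (a * b) := by group
      _ = (a * b)⁻¹ * ((a * b)⁻¹ * g * (a * b)) * (a * b) := by rw [e7]
      _ = (a * b * (a * b))⁻¹ * g * (a * b * (a * b)) := by group
      _ = g := by rw [h.w]; group
  have e9 : μ' = μ := inv_mul_eq_one.1 (mul_eq_left.1 e8)
  have e10 : g * g₁ = 1 := by
    apply hB _ (mul_mem gB g₁B)
    have : a⁻¹ * (g * g₁) * a = g₁ * g := by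
      calc a⁻¹ * (g * g₁) * a = (a⁻¹ * g * a) * (a⁻¹ * g₁ * a) := by group
        _ = g₁ * (μ * g) * μ⁻¹ := by rw [e1, e2]; group
        _ = g₁ * g := by rw [← (gM μ hμ).eq]; group
    rw [this]
    exact mul_mem g₁B gB
  have e11 : g₁ = g⁻¹ := eq_inv_of_mul_eq_one_right e10
  refine ⟨μ, hμ, ?_, by rw [e1, e11], ga2⟩
  show b * μ = μ * b
  rw [e9] at eμ'
  nth_rw 1 [eμ']
  group

theorem stepE {H : Type*} [Group H] {a b : H} (h : TP_s5 a b) {f : H →* H}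
    (fa : f a = a⁻¹) (fb : f b = b⁻¹) (M T : Subgroup H) [hMn : M.Normal] [hTn : T.Normal]
    (hMA : M ≤ Subgroup.zpowers a) (hMT : M ≤ T)
    (hT : ∀ t ∈ T, ∃ g ∈ Subgroup.zpowers b, ∃ μ ∈ M, g ∈ T ∧ t = g * μ)
    (hB : ∀ g ∈ Subgroup.zpowers b, a⁻¹ * g * a ∈ Subgroup.zpowers b → g = 1)
    (hM : ∀ x ∈ Subgroup.zpowers a, b⁻¹ * x * b ∈ Subgroup.zpowers a → x ∈ M)
    (hBQ : ∀ g ∈ Subgroup.zpowers (b : H ⧸ T), (a : H ⧸ T)⁻¹ * g * (a : H ⧸ T) ∈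
      Subgroup.zpowers (b : H ⧸ T) → g = 1)
    (hQ : TP_s5 (a : H ⧸ T) (b : H ⧸ T)) (hfin : IsOfFinOrder (a : H ⧸ T))
    (hind : (b : H ⧸ T)⁻¹ * ((a : H ⧸ T) * a) * (b : H ⧸ T) ∈ Subgroup.zpowers (a : H ⧸ T)) :
    b⁻¹ * (a * a) * b ∈ Subgroup.zpowers a := by
  have ha := Subgroup.mem_zpowers a
  have hb := Subgroup.mem_zpowers b
  have aM : ∀ ν ∈ M, Commute a ν := fun ν hν => zcomm ha (hMA hν)
  have bab : b * a * b = a⁻¹ := by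
    have := h.w
    rw [eq_comm, inv_eq_iff_mul_eq_one, ← this]; group
  have hD := fun {g : H} => @lemD_s5 H _ a b h f fa fb M T _ _ hMA hT hB g
  have Mconj : ∀ x ∈ M, b⁻¹ * x * b ∈ M := by
    intro x hx
    have := hMn.conj_mem x hx b⁻¹
    rwa [inv_inv] at this
  have flip : ∀ ν ∈ M, b⁻¹ * (b⁻¹ * ν * b) * b = ν := fun ν hν =>
    h.flip (aM ν hν).eq.symm (aM _ (Mconj ν hν)).eq.symm
  have hb2 : b * b ∈ T → b⁻¹ * (a * a) * b ∈ Subgroup.zpowers a := by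
    intro hbT
    have hc : ∀ ν ∈ M, Commute (b * b) ν := by
      intro ν hν
      show b * b * ν = ν * (b * b)
      nth_rw 1 [← flip ν hν]
      group
    obtain ⟨μ, hμ, bμ, e, -⟩ := hD (mul_mem hb hb) hbT hc
    have e1 : b⁻¹ * (a * a) * b = μ⁻¹ * a⁻¹ * a⁻¹ := by
      calc b⁻¹ * (a * a) * b
          = b⁻¹ * b⁻¹ * (b * a * b) * b⁻¹ * b⁻¹ * (b * a * b) := by group
        _ = b⁻¹ * b⁻¹ * (a⁻¹ * (b * b) * a)⁻¹ * a⁻¹ * a⁻¹ := by rw [bab]; group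
        _ = (b * b)⁻¹ * (μ⁻¹ * (b * b)) * a⁻¹ * a⁻¹ := by rw [e]; simp [mul_assoc]
        _ = μ⁻¹ * a⁻¹ * a⁻¹ := by rw [← ((hc μ hμ).inv_right).eq]; group
    rw [e1]
    exact mul_mem (mul_mem (inv_mem (hMA hμ)) (inv_mem ha)) (inv_mem ha)
  have hQb2 : (b : H ⧸ T) * b = 1 → b⁻¹ * (a * a) * b ∈ Subgroup.zpowers a := by
    intro e
    rw [← QuotientGroup.mk_mul] at e
    exact hb2 ((QuotientGroup.eq_one_iff _).1 e)
  obtain ⟨x, δ, δB, δT, e⟩ : ∃ x : ℤ, ∃ δ ∈ Subgroup.zpowers b, δ ∈ T ∧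
      b⁻¹ * (a * a) * b = a ^ x * δ := by
    obtain ⟨x, hx⟩ := hind
    simp only at hx
    have ht : (a ^ x)⁻¹ * (b⁻¹ * (a * a) * b) ∈ T := by
      rw [← QuotientGroup.eq]
      simpa using hx
    obtain ⟨g, gB, μ, hμ, gT, e⟩ := hT _ (inv_mem ht)
    obtain ⟨y, hy⟩ := hMA (inv_mem hμ)
    simp only at hy
    refine ⟨x + y, g⁻¹, inv_mem gB, inv_mem gT, ?_⟩
    rw [zpow_add, hy]
    calc b⁻¹ * (a * a) * b = a ^ x * (((a ^ x)⁻¹ * (b⁻¹ * (a * a) * b))⁻¹)⁻¹ := by simp [mul_assoc]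
      _ = _ := by rw [e]; group
  have eQ : (b : H ⧸ T)⁻¹ * ((a : H ⧸ T) * a) * b = (a : H ⧸ T) ^ x := by
    have h1 := congrArg (QuotientGroup.mk' T) e
    have h2 : (δ : H ⧸ T) = 1 := (QuotientGroup.eq_one_iff _).2 δT
    simpa [h2] using h1
  have δM : ∀ ν ∈ M, Commute δ ν := by
    intro ν hν
    have e1 : δ = (a ^ x)⁻¹ * (b⁻¹ * (a * a) * b) := by rw [e]; group
    rw [e1]
    refine Commute.mul_left (((aM ν hν).zpow_left x).inv_left) ?_
    have h1 := aM _ (Mconj ν hν)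
    have h2 : Commute (a * a) (b⁻¹ * ν * b) := h1.mul_left h1
    show b⁻¹ * (a * a) * b * ν = ν * (b⁻¹ * (a * a) * b)
    calc b⁻¹ * (a * a) * b * ν = b⁻¹ * (a * a) * b * (b⁻¹ * (b⁻¹ * ν * b) * b) := by
          rw [flip ν hν]
      _ = b⁻¹ * ((a * a) * (b⁻¹ * ν * b)) * b := by group
      _ = b⁻¹ * (b⁻¹ * ν * b) * b * (b⁻¹ * (a * a) * b) := by rw [h2.eq]; group
      _ = _ := by rw [flip ν hν]
  rcases Int.even_or_odd' x with ⟨z, rfl | rfl⟩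
  · obtain ⟨μ, hμ, bμ, eμ, δa⟩ := hD δB δT δM
    obtain ⟨P, hP⟩ : ∃ P, P = a * a := ⟨_, rfl⟩
    have aP : a * P = P * a := by rw [hP]; group
    have hPA : P ∈ Subgroup.zpowers a := by rw [hP]; exact mul_mem ha ha
    have hPz : a ^ (2 * z) = P ^ z := by rw [zpow_mul, hP]; simp [pow_two]
    rw [hPz, ← hP] at e
    rw [← hP] at δa
    have bδ : b * δ = δ * b := zcomm hb δB
    have fz : ∀ n : ℤ, (P ^ z * δ) ^ n = P ^ (z * n) * δ ^ n := by
      intro n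
      rw [(Commute.zpow_right δa z).symm.mul_zpow, zpow_mul]
    have hPP : ∀ (n : ℤ), b⁻¹ * P ^ n * b = (b⁻¹ * P * b) ^ n := by
      intro n
      have := conj_zpow (a := b⁻¹) (b := P) (i := n)
      rw [inv_inv] at this
      exact this.symm
    have e' : b * P * b⁻¹ = P ^ z * δ := by
      have h1 := congrArg f e
      simp only [map_mul, map_inv, fb, f_inv fa hPA, f_inv fb δB, map_zpow, inv_inv] at h1
      calc b * P * b⁻¹ = (b * P⁻¹ * b⁻¹)⁻¹ := by group
        _ = δ * P ^ z := by rw [h1]; group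
        _ = P ^ z * δ := (Commute.zpow_right δa z).eq
    have bδ' : b⁻¹ * δ * b = δ := by rw [mul_assoc, ← bδ]; group
    have k1 : P = P ^ (z * z) * δ ^ (z + 1) := by
      calc P = b⁻¹ * (b * P * b⁻¹) * b := by group
        _ = (b⁻¹ * P ^ z * b) * (b⁻¹ * δ * b) := by rw [e']; group
        _ = P ^ (z * z) * δ ^ z * δ := by rw [hPP, e, fz, bδ']
        _ = _ := by rw [zpow_add_one, mul_assoc]
    have hw : (a * b)⁻¹ * P * (a * b) = P ^ z * δ := by
      calc (a * b)⁻¹ * P * (a * b) = b⁻¹ * (a⁻¹ * (P * a)) * b := by group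
        _ = b⁻¹ * P * b := by rw [← aP]; group
        _ = _ := e
    have bμ' : b⁻¹ * μ * b = μ := by rw [mul_assoc, ← bμ.eq]; group
    have aPz : a * P ^ z = P ^ z * a := by
      have : Commute a P := aP
      exact (this.zpow_right z).eq
    have k2 : P = P ^ (z * z) * δ ^ (z - 1) * μ := by
      calc P = (a * b * (a * b))⁻¹ * P * (a * b * (a * b)) := by rw [h.w]; group
        _ = (a * b)⁻¹ * ((a * b)⁻¹ * P * (a * b)) * (a * b) := by group
        _ = b⁻¹ * (a⁻¹ * (P ^ z * a)) * b * (b⁻¹ * (a⁻¹ * δ * a) * b) := by rw [hw]; group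
        _ = (b⁻¹ * P ^ z * b) * ((b⁻¹ * δ * b)⁻¹ * (b⁻¹ * μ * b)) := by
            rw [← aPz, eμ]; group
        _ = P ^ (z * z) * δ ^ z * (δ⁻¹ * μ) := by rw [hPP, e, fz, bδ', bμ']
        _ = _ := by rw [zpow_sub_one]; group
    have k1' : δ ^ (z + 1) = 1 := by
      apply h.inf _ _ (zpow_mem δB _)
      have : δ ^ (z + 1) = (P ^ (z * z))⁻¹ * P := by
        exact eq_inv_mul_of_mul_eq k1.symm
      rw [this]
      exact mul_mem (inv_mem (zpow_mem hPA _)) hPA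
    have k2' : δ ^ (z - 1) = 1 := by
      apply h.inf _ _ (zpow_mem δB _)
      have : δ ^ (z - 1) = (P ^ (z * z))⁻¹ * P * μ⁻¹ := by
        exact eq_mul_inv_of_mul_eq (eq_inv_mul_of_mul_eq (by rw [← mul_assoc]; exact k2.symm))
      rw [this]
      exact mul_mem (mul_mem (inv_mem (zpow_mem hPA _)) hPA) (inv_mem (hMA hμ))
    have k3 : δ ^ (2 : ℤ) = 1 := by
      have : (2 : ℤ) = (z + 1) - (z - 1) := by ring
      rw [this, zpow_sub, k1', k2']; simp
    have k4 : P ^ (2 : ℤ) ∈ M := by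
      apply hM _ (zpow_mem hPA _)
      rw [hPP, e, fz, k3, mul_one]
      exact zpow_mem hPA _
    rw [← hP]
    rcases Int.even_or_odd' z with ⟨y, rfl | rfl⟩
    · have h1 : b⁻¹ * P * b ∈ T := by
        rw [e, zpow_mul]
        exact mul_mem (zpow_mem (hMT k4) _) δT
      have h2 : P ∈ T := by
        have := hTn.conj_mem _ h1 b
        convert this using 1; group
      obtain ⟨g, gB, ν, hν, gT, e3⟩ := hT _ h2
      have h3 : g = 1 := by
        apply h.inf _ _ gB
        have : g = P * ν⁻¹ := by rw [e3]; group
        rw [this]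
        exact mul_mem hPA (inv_mem (hMA hν))
      rw [e3, h3, one_mul]
      exact hMA (Mconj ν hν)
    · rw [hP]
      apply hQb2
      obtain ⟨α, hα⟩ : ∃ α : H ⧸ T, α = (a : H ⧸ T) := ⟨_, rfl⟩
      obtain ⟨β, hβ⟩ : ∃ β : H ⧸ T, β = (b : H ⧸ T) := ⟨_, rfl⟩
      have q4 : α ^ (4 : ℤ) = 1 := by
        have h1 : ((P ^ (2 : ℤ) : H) : H ⧸ T) = 1 := (QuotientGroup.eq_one_iff _).2 (hMT k4)
        rw [hP] at h1
        rw [hα, ← h1]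
        rw [QuotientGroup.mk_zpow, QuotientGroup.mk_mul]
        generalize (a : H ⧸ T) = u
        show u ^ ((4 : ℕ) : ℤ) = (u * u) ^ ((2 : ℕ) : ℤ)
        rw [zpow_natCast, zpow_natCast, ← pow_two, ← pow_mul]
      have eQ' : β⁻¹ * (α * α) * β = α * α := by
        have : α ^ (2 * (2 * y + 1)) = α * α := by
          have : 2 * (2 * y + 1) = 4 * y + 2 := by ring
          rw [this, zpow_add, zpow_mul, q4]; simp [pow_two]
        refine Eq.trans ?_ this
        rw [hα, hβ]
        exact eQ
      have qbab : β * α * β = α⁻¹ := by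
        have := congrArg (QuotientGroup.mk' T) bab
        rw [hα, hβ]
        simpa using this
      have q5 : β * β * α * β * β = α := by
        calc β * β * α * β * β = β * (β * α * β) * β := by simp [mul_assoc]
          _ = β * α⁻¹ * β := by rw [qbab]
          _ = (β * α * β) * (β⁻¹ * (α * α) * β)⁻¹ := by simp [mul_assoc]
          _ = α⁻¹ * (α * α)⁻¹ := by rw [eQ', qbab]
          _ = α * (α ^ (4 : ℤ))⁻¹ := by group
          _ = α := by rw [q4]; group
      rw [← hα, ← hβ] at hBQ
      rw [← hβ]
      apply hBQ _ (mul_mem (Subgroup.mem_zpowers β) (Subgroup.mem_zpowers β))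
      have q6 : α⁻¹ * (β * β) * α = β⁻¹ * β⁻¹ := by
        calc α⁻¹ * (β * β) * α = α⁻¹ * (β * β * α * β * β) * β⁻¹ * β⁻¹ := by group
          _ = _ := by rw [q5]; group
      rw [q6]
      exact mul_mem (inv_mem (Subgroup.mem_zpowers β)) (inv_mem (Subgroup.mem_zpowers β))
  · apply hQb2
    obtain ⟨α, hα⟩ : ∃ α : H ⧸ T, α = (a : H ⧸ T) := ⟨_, rfl⟩
    obtain ⟨β, hβ⟩ : ∃ β : H ⧸ T, β = (b : H ⧸ T) := ⟨_, rfl⟩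
    have qbab : β * α * β = α⁻¹ := by
      have := congrArg (QuotientGroup.mk' T) bab
      rw [hα, hβ]
      simpa using this
    rw [← hα, ← hβ] at eQ hQ
    rw [← hα] at hfin
    rw [← hβ]
    have hpos := hfin.orderOf_pos
    have hpow : ∀ n : ℕ, β⁻¹ * (α * α) ^ n * β = α ^ ((2 * z + 1) * n) := by
      intro n
      have := conj_pow (a := β⁻¹) (b := α * α) (i := n)
      rw [inv_inv, eQ] at this
      rw [← this, zpow_mul, zpow_natCast]
    rcases Nat.even_or_odd' (orderOf α) with ⟨k, hk | hk⟩
    · exfalso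
      have h1 := hpow k
      have h2 : (α * α) ^ k = 1 := by
        rw [← pow_two, ← pow_mul, ← hk, pow_orderOf_eq_one]
      rw [h2] at h1
      have h3 : α ^ ((2 * z + 1) * k) = 1 := by rw [← h1]; group
      rw [← orderOf_dvd_iff_zpow_eq_one, hk] at h3
      obtain ⟨c, hc⟩ := h3
      push_cast at hc
      have hk0 : (k : ℤ) ≠ 0 := by omega
      have h4 : 2 * z + 1 = 2 * c := by
        apply mul_right_cancel₀ hk0
        rw [hc]; ring
      omega
    · have h1 := hpow (k + 1)
      have h2 : (α * α) ^ (k + 1) = α := by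
        rw [← pow_two, ← pow_mul]
        have : 2 * (k + 1) = orderOf α + 1 := by rw [hk]; ring
        rw [this, pow_add, pow_orderOf_eq_one]; simp
      rw [h2] at h1
      have h3 : β * β = (α ^ ((2 * z + 1) * ((k + 1 : ℕ) : ℤ)) * α)⁻¹ := by
        rw [← h1]
        calc β * β = α⁻¹ * (β⁻¹ * (β⁻¹ * (β * α * β)))⁻¹ := by rw [qbab]; simp [mul_assoc]
          _ = _ := by simp [mul_assoc]
      have βm := Subgroup.mem_zpowers β
      refine hQ.inf _ ?_ (mul_mem βm βm)
      rw [h3]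
      exact inv_mem (mul_mem (zpow_mem (Subgroup.mem_zpowers α) _) (Subgroup.mem_zpowers α))
universe u

theorem mainE (n : ℕ) : ∀ (H : Type u) [Group H] [Finite H] (a b : H), Nat.card H ≤ n →
    TP_s5 a b → Reg a b → (Subgroup.zpowers b).normalCore = ⊥ →
    b⁻¹ * (a * a) * b ∈ Subgroup.zpowers a := by
  induction n with
  | zero =>
    intro H _ _ a b hn
    have : 0 < Nat.card H := Nat.card_pos
    omega
  | succ n ih =>
    intro H _ _ a b hn h hreg hcore
    have ha := Subgroup.mem_zpowers a
    have hB : ∀ g ∈ Subgroup.zpowers b, a⁻¹ * g * a ∈ Subgroup.zpowers b → g = 1 := by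
      intro g hg hg'
      have := h.swap.core_mem hg hg'
      rw [hcore] at this
      exact this
    obtain ⟨M, hMdef⟩ : ∃ M, M = (Subgroup.zpowers a).normalCore := ⟨_, rfl⟩
    have hMn : M.Normal := by rw [hMdef]; infer_instance
    have hMA : M ≤ Subgroup.zpowers a := by rw [hMdef]; exact Subgroup.normalCore_le _
    have hM : ∀ x ∈ Subgroup.zpowers a, b⁻¹ * x * b ∈ Subgroup.zpowers a → x ∈ M := by
      intro x hx hx'
      rw [hMdef]
      exact h.core_mem hx hx'
    by_cases hbot : M = ⊥
    · rcases le_total (Nat.card (Subgroup.zpowers b)) (Nat.card (Subgroup.zpowers a)) with hc | hc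
      · have hb := h.count hc (fun x hx hx' => by
          have := hM x hx hx'
          rw [hbot] at this
          exact this)
        exact mul_mem (mul_mem (inv_mem hb) (mul_mem ha ha)) hb
      · have h1 := h.swap.count hc hB
        have h2 := h.inf _ ha h1
        rw [h2]
        simp
    · have hKM : M ≤ Subgroup.zpowers b ⊔ M := le_sup_right
      have hbK : b ∈ Subgroup.zpowers b ⊔ M :=
        Subgroup.mem_sup_left (Subgroup.mem_zpowers b)
      obtain ⟨K, hK⟩ : ∃ K, K = Subgroup.zpowers b ⊔ M := ⟨_, rfl⟩
      rw [← hK] at hKM hbK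
      have hMT : M ≤ K.normalCore := by
        rw [Subgroup.normal_le_normalCore]; exact hKM
      have hT : ∀ t ∈ K.normalCore, ∃ g ∈ Subgroup.zpowers b, ∃ μ ∈ M,
          g ∈ K.normalCore ∧ t = g * μ := by
        intro t ht
        have h1 := Subgroup.normalCore_le _ ht
        rw [hK, Subgroup.mem_sup_of_normal_right] at h1
        obtain ⟨g, hg, μ, hμ, e⟩ := h1
        refine ⟨g, hg, μ, hμ, ?_, e.symm⟩
        have : g = t * μ⁻¹ := by rw [← e]; group
        rw [this]
        exact mul_mem ht (inv_mem (hMT hμ))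
      have hQ : TP_s5 (a : H ⧸ K.normalCore) (b : H ⧸ K.normalCore) := by
        apply h.quot
        intro i j hij
        obtain ⟨g, hg, μ, hμ, -, e⟩ := hT _ (inv_mem hij)
        have h1 : a ^ i * μ⁻¹ = b ^ j * g := by
          calc a ^ i * μ⁻¹ = b ^ j * ((a ^ i)⁻¹ * b ^ j)⁻¹ * μ⁻¹ := by group
            _ = _ := by rw [e]; group
        have h2 : a ^ i * μ⁻¹ = 1 := by
          apply h.inf _ (mul_mem (zpow_mem ha i) (inv_mem (hMA hμ)))
          rw [h1]
          exact mul_mem (zpow_mem (Subgroup.mem_zpowers b) j) hg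
        rw [mul_inv_eq_one.1 h2]
        exact hMT hμ
      have hcQ := quot_core b K hbK
      obtain ⟨f, fa, fb⟩ := hreg
      have fs := reg_surj h fa fb
      have hfM : ∀ x ∈ M, f x ∈ M := by
        intro x hx
        rw [f_inv fa (hMA hx)]
        exact inv_mem hx
      have hfK : ∀ x ∈ K, f x ∈ K := by
        intro x hx
        rw [hK, Subgroup.mem_sup_of_normal_right] at hx
        obtain ⟨g, hg, μ, hμ, rfl⟩ := hx
        rw [map_mul, f_inv fb hg]
        refine mul_mem (inv_mem ?_) (hKM (hfM μ hμ))
        rw [hK]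
        exact Subgroup.mem_sup_left hg
      have hrQ : Reg (a : H ⧸ K.normalCore) (b : H ⧸ K.normalCore) := by
        have hle : K.normalCore ≤ K.normalCore.comap f := by
          intro x hx
          exact reg_core fs hfK hx
        refine ⟨QuotientGroup.map _ _ f hle, ?_, ?_⟩
        · show ((f a : H) : H ⧸ K.normalCore) = _
          rw [fa]; rfl
        · show ((f b : H) : H ⧸ K.normalCore) = _
          rw [fb]; rfl
      have hcard : Nat.card (H ⧸ K.normalCore) ≤ n := by
        have h1 := Subgroup.card_eq_card_quotient_mul_card_subgroup K.normalCore
        have h2 : 1 < Nat.card K.normalCore := by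
          rw [Subgroup.one_lt_card_iff_ne_bot]
          intro h3
          rw [h3, le_bot_iff] at hMT
          exact hbot hMT
        have h4 : 0 < Nat.card (H ⧸ K.normalCore) := Nat.card_pos
        nlinarith
      have hind := ih (H ⧸ K.normalCore) a b hcard hQ hrQ hcQ
      refine stepE h fa fb M K.normalCore hMA hMT hT hB hM ?_ hQ (isOfFinOrder_of_finite _) hind
      intro g hg hg'
      have := hQ.swap.core_mem hg hg'
      rw [hcQ] at this
      exact this

theorem central_reg {G : Type*} [Group G] {a b : G} (h : TP_s5 a b) (i e : ℤ)
    (hc : Commute a (b ^ e)) (rel : b⁻¹ * a = a ^ i * (b * b ^ e)) : Reg a b := by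
  let α : G × G := (a, a⁻¹)
  let β : G × G := (b, b⁻¹)
  have w1 : β * α = α⁻¹ * β⁻¹ := by
    apply Prod.ext
    · show b * a = a⁻¹ * b⁻¹
      have := h.swap.w
      rw [← mul_inv_rev, eq_inv_iff_mul_eq_one, this]
    · show b⁻¹ * a⁻¹ = a⁻¹⁻¹ * b⁻¹⁻¹
      have := h.w
      rw [inv_inv, inv_inv, ← mul_inv_rev, inv_eq_iff_mul_eq_one, this]
  have w2 : β⁻¹ * α⁻¹ = α * β := by
    rw [← mul_inv_rev, inv_eq_iff_mul_eq_one]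
    calc α * β * (α * β) = α * (β * α) * β := by group
      _ = 1 := by rw [w1]; group
  have hcν : Commute α (β ^ e) := by
    apply Prod.ext
    · exact hc.eq
    · show a⁻¹ * b⁻¹ ^ e = b⁻¹ ^ e * a⁻¹
      rw [inv_zpow]
      exact hc.inv_inv.eq
  have hcb : Commute b (b ^ e) := Commute.self_zpow b e
  have rel2 : b * a⁻¹ = a⁻¹ ^ i * (b⁻¹ * b⁻¹ ^ e) := by
    calc b * a⁻¹ = b * (b⁻¹ * a)⁻¹ * b⁻¹ := by group
      _ = b * (b * b ^ e)⁻¹ * (a ^ i)⁻¹ * b⁻¹ := by rw [rel]; group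
      _ = (b * (b ^ e)⁻¹) * b⁻¹ * (a ^ i)⁻¹ * b⁻¹ := by group
      _ = ((b ^ e)⁻¹ * (a ^ i)⁻¹) * b⁻¹ := by rw [(hcb.inv_right).eq]; group
      _ = (a ^ i)⁻¹ * ((b ^ e)⁻¹ * b⁻¹) := by
        rw [← ((hc.zpow_left i).inv_inv).eq]; group
      _ = _ := by rw [← hcb.inv_inv.eq, inv_zpow, inv_zpow]
  have r1 : β⁻¹ * α = α ^ i * (β * β ^ e) := by
    apply Prod.ext
    · exact rel
    · show b⁻¹⁻¹ * a⁻¹ = a⁻¹ ^ i * (b⁻¹ * b⁻¹ ^ e)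
      rw [inv_inv]
      exact rel2
  have r2 : β * α⁻¹ = α⁻¹ ^ i * (β⁻¹ * β⁻¹ ^ e) := by
    apply Prod.ext
    · exact rel2
    · show b⁻¹ * a⁻¹⁻¹ = a⁻¹⁻¹ ^ i * (b⁻¹⁻¹ * b⁻¹⁻¹ ^ e)
      rw [inv_inv, inv_inv]
      exact rel
  have key : ∀ x : ℤ, (∃ u v : ℤ, β * α ^ x = α ^ u * β ^ v) ∧
      (∃ u v : ℤ, β⁻¹ * α ^ x = α ^ u * β ^ v) := by
    intro x
    induction x using Int.induction_on with
    | zero => exact ⟨⟨0, 1, by simp⟩, ⟨0, -1, by simp⟩⟩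
    | succ x ih =>
      obtain ⟨⟨u, v, e1⟩, ⟨u', v', e2⟩⟩ := ih
      refine ⟨⟨-1 + u', v', ?_⟩, ⟨i + u, v + e, ?_⟩⟩
      · calc β * α ^ ((x : ℤ) + 1) = (β * α) * α ^ (x : ℤ) := by group
          _ = α⁻¹ * (β⁻¹ * α ^ (x : ℤ)) := by rw [w1]; group
          _ = _ := by rw [e2]; group
      · calc β⁻¹ * α ^ ((x : ℤ) + 1) = (β⁻¹ * α) * α ^ (x : ℤ) := by group
          _ = α ^ i * β * (β ^ e * α ^ (x : ℤ)) := by rw [r1]; group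
          _ = α ^ i * (β * α ^ (x : ℤ)) * β ^ e := by
            rw [← (hcν.zpow_left x).eq]; group
          _ = _ := by rw [e1]; group
    | pred x ih =>
      obtain ⟨⟨u, v, e1⟩, ⟨u', v', e2⟩⟩ := ih
      refine ⟨⟨-i + u', v' - e, ?_⟩, ⟨1 + u, v, ?_⟩⟩
      · calc β * α ^ (-(x : ℤ) - 1) = (β * α⁻¹) * α ^ (-(x : ℤ)) := by group
          _ = α⁻¹ ^ i * β⁻¹ * ((β ^ e)⁻¹ * α ^ (-(x : ℤ))) := by
            rw [r2, inv_zpow β]; group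
          _ = α⁻¹ ^ i * (β⁻¹ * α ^ (-(x : ℤ))) * (β ^ e)⁻¹ := by
            rw [← ((hcν.zpow_left (-(x : ℤ))).inv_right).eq]; group
          _ = _ := by rw [e2]; group
      · calc β⁻¹ * α ^ (-(x : ℤ) - 1) = (β⁻¹ * α⁻¹) * α ^ (-(x : ℤ)) := by group
          _ = α * (β * α ^ (-(x : ℤ))) := by rw [w2]; group
          _ = _ := by rw [e1]; group
  let K := Subgroup.closure ({α, β} : Set (G × G))
  have hK : ∀ k ∈ K, ∃ u v : ℤ, k = α ^ u * β ^ v := by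
    intro k hk
    induction hk using Subgroup.closure_induction_left with
    | one => exact ⟨0, 0, by simp⟩
    | mul_left x hx y hy ih =>
      obtain ⟨u, v, rfl⟩ := ih
      rcases hx with rfl | hx
      · exact ⟨1 + u, v, by rw [zpow_add, zpow_one, mul_assoc]⟩
      · rw [Set.mem_singleton_iff] at hx
        obtain ⟨u', v', e1⟩ := (key u).1
        refine ⟨u', v' + v, ?_⟩
        rw [hx, ← mul_assoc, e1, zpow_add, mul_assoc]
    | inv_mul_cancel x hx y hy ih =>
      obtain ⟨u, v, rfl⟩ := ih
      rcases hx with rfl | hx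
      · exact ⟨-1 + u, v, by rw [zpow_add, zpow_neg_one, mul_assoc]⟩
      · rw [Set.mem_singleton_iff] at hx
        obtain ⟨u', v', e1⟩ := (key u).2
        refine ⟨u', v' + v, ?_⟩
        rw [hx, ← mul_assoc, e1, zpow_add, mul_assoc]
  let π : K →* G := (MonoidHom.fst G G).comp K.subtype
  have αK : α ∈ K := Subgroup.subset_closure (by simp)
  have βK : β ∈ K := Subgroup.subset_closure (by simp)
  have hinj : Function.Injective π := by
    rw [injective_iff_map_eq_one]
    rintro ⟨k, hk⟩ h1
    obtain ⟨u, v, rfl⟩ := hK k hk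
    have h2 : a ^ u * b ^ v = 1 := h1
    have h3 : a ^ u = 1 := by
      apply h.inf _ (zpow_mem (Subgroup.mem_zpowers a) u)
      rw [eq_inv_of_mul_eq_one_left h2]
      exact inv_mem (zpow_mem (Subgroup.mem_zpowers b) v)
    have h4 : b ^ v = 1 := by rwa [h3, one_mul] at h2
    apply Subtype.ext
    apply Prod.ext
    · exact h2
    · show a⁻¹ ^ u * b⁻¹ ^ v = 1
      rw [inv_zpow, inv_zpow, h3, h4]; simp
  have hsurj : Function.Surjective π := by
    rw [← MonoidHom.range_eq_top, eq_top_iff, ← h.gen, Subgroup.closure_le]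
    rintro x (rfl | hx)
    · exact ⟨⟨α, αK⟩, rfl⟩
    · rw [Set.mem_singleton_iff] at hx
      subst hx
      exact ⟨⟨β, βK⟩, rfl⟩
  let E := MulEquiv.ofBijective π ⟨hinj, hsurj⟩
  refine ⟨((MonoidHom.snd G G).comp K.subtype).comp E.symm.toMonoidHom, ?_, ?_⟩
  · have : E.symm a = ⟨α, αK⟩ := by
      rw [MulEquiv.symm_apply_eq]; rfl
    show (MonoidHom.snd G G) (E.symm a).1 = _
    rw [this]; rfl
  · have : E.symm b = ⟨β, βK⟩ := by
      rw [MulEquiv.symm_apply_eq]; rfl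
    show (MonoidHom.snd G G) (E.symm b).1 = _
    rw [this]; rfl

theorem Reg.equiv {G : Type*} [Group G] {a b : G} (h : TP_s5 a b) (hr : Reg a b) :
    ∃ φ : G ≃* G, φ a = a⁻¹ ∧ φ b = b⁻¹ := by
  obtain ⟨f, fa, fb⟩ := hr
  have hff : f.comp f = MonoidHom.id G := by
    apply MonoidHom.eq_of_eqOn_dense h.gen
    rintro x (rfl | hx)
    · simp [fa]
    · rw [Set.mem_singleton_iff] at hx
      subst hx
      simp [fb]
  exact ⟨MonoidHom.toMulEquiv f f hff hff, fa, fb⟩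

theorem TP_s5.map {H L : Type*} [Group H] [Group L] {a b : H} (h : TP_s5 a b) (e : H ≃* L) :
    TP_s5 (e a) (e b) where
  gen := by
    have := congrArg (Subgroup.map e.toMonoidHom) h.gen
    rw [MonoidHom.map_closure, Set.image_pair] at this
    rw [Subgroup.map_top_of_surjective _ e.surjective] at this
    exact this
  w := by rw [← map_mul, ← map_mul, h.w, map_one]
  inf := by
    rintro x ⟨i, rfl⟩ ⟨j, hj⟩
    have hj : e b ^ j = e a ^ i := hj
    show e a ^ i = 1
    have h1 : b ^ j = a ^ i := by
      apply e.injective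
      rw [map_zpow, map_zpow, hj]
    have h2 := h.inf (a ^ i) ⟨i, rfl⟩ ⟨j, h1⟩
    rw [← map_zpow, h2, map_one]
  tight := by
    intro g
    obtain ⟨i, j, e1⟩ := h.tight (e.symm g)
    refine ⟨i, j, ?_⟩
    rw [← map_zpow, ← map_zpow, ← map_mul, ← e1, e.apply_symm_apply]

theorem TP_s5.rot {H : Type*} [Group H] {a b : H} (h : TP_s5 a b) (p q : ℕ) (ha : orderOf a = p)
    (hb : orderOf b = q) (hp : 2 ≤ p) (hq : 2 ≤ q) : IsRotPair a b p q := by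
  refine ⟨h.gen, ha, hb, hp, hq, by rw [pow_two, h.w], ?_⟩
  rw [eq_bot_iff]
  rintro x ⟨h1, h2⟩
  exact h.inf x h1 h2

/-- The quotient by the core of `⟨b⟩` is orientably regular. -/
theorem quot_reg {G : Type*} [Group G] [Finite G] (a b : G)
    (p q : ℕ) (h : IsAtomicPair a b p q) (hN : (Subgroup.zpowers b).normalCore ≠ ⊥)
    (hQ : TP_s5 (a : G ⧸ (Subgroup.zpowers b).normalCore)
      (b : G ⧸ (Subgroup.zpowers b).normalCore)) :
    Reg (a : G ⧸ (Subgroup.zpowers b).normalCore)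
      (b : G ⧸ (Subgroup.zpowers b).normalCore) := by
  obtain ⟨⟨-, oa, ob, hp, hq, -, hinf⟩, -, -, -, hat⟩ := h
  by_cases h1 : (b : G ⧸ (Subgroup.zpowers b).normalCore) = 1
  · refine ⟨MonoidHom.id _, ?_, ?_⟩
    · have := hQ.w
      rw [h1, mul_one] at this
      exact eq_inv_of_mul_eq_one_left this
    · rw [h1]; simp
  by_contra hreg
  let e : G ⧸ (Subgroup.zpowers b).normalCore ≃*
    Shrink.{0} (G ⧸ (Subgroup.zpowers b).normalCore) := Shrink.mulEquiv.symm
  have hTP := hQ.map e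
  have oa' : orderOf (a : G ⧸ (Subgroup.zpowers b).normalCore) = p := by
    rw [← oa]
    apply Nat.dvd_antisymm
    · exact orderOf_map_dvd (QuotientGroup.mk' (Subgroup.zpowers b).normalCore) a
    · rw [orderOf_dvd_iff_pow_eq_one]
      have h2 := pow_orderOf_eq_one (a : G ⧸ (Subgroup.zpowers b).normalCore)
      rw [← QuotientGroup.mk_pow, QuotientGroup.eq_one_iff] at h2
      have h3 := Subgroup.normalCore_le _ h2
      have h4 : a ^ orderOf (a : G ⧸ (Subgroup.zpowers b).normalCore) ∈
        Subgroup.zpowers a ⊓ Subgroup.zpowers b := ⟨pow_mem (Subgroup.mem_zpowers a) _, h3⟩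
      rw [hinf] at h4
      exact h4
  have hd : orderOf (b : G ⧸ (Subgroup.zpowers b).normalCore) ∣ q := by
    rw [← ob]
    exact orderOf_map_dvd (QuotientGroup.mk' (Subgroup.zpowers b).normalCore) b
  have hne : orderOf (b : G ⧸ (Subgroup.zpowers b).normalCore) ≠ q := by
    intro h2
    apply hN
    rw [eq_bot_iff]
    intro x hx
    obtain ⟨j, rfl⟩ := Subgroup.normalCore_le _ hx
    have hx : b ^ j ∈ (Subgroup.zpowers b).normalCore := hx
    show b ^ j = 1
    rw [← QuotientGroup.eq_one_iff, QuotientGroup.mk_zpow, ← orderOf_dvd_iff_zpow_eq_one,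
      h2, ← ob, orderOf_dvd_iff_zpow_eq_one] at hx
    exact hx
  have hlt : orderOf (b : G ⧸ (Subgroup.zpowers b).normalCore) < q :=
    lt_of_le_of_ne (Nat.le_of_dvd (by omega) hd) hne
  have h2 : 2 ≤ orderOf (b : G ⧸ (Subgroup.zpowers b).normalCore) := by
    have h3 : orderOf (b : G ⧸ (Subgroup.zpowers b).normalCore) ≠ 1 := by
      rw [Ne, orderOf_eq_one_iff]; exact h1
    have h4 := orderOf_pos (b : G ⧸ (Subgroup.zpowers b).normalCore)
    omega
  refine hat (Shrink.{0} (G ⧸ (Subgroup.zpowers b).normalCore)) inferInstance inferInstance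
    (e a) (e b) _ hlt (hTP.rot _ _ ?_ ?_ hp h2) hTP.tight ?_ ?_
  · rw [MulEquiv.orderOf_eq, oa']
  · rw [MulEquiv.orderOf_eq]
  · rintro ⟨φ, φa, φb⟩
    apply hreg
    refine ⟨(e.symm.toMonoidHom.comp φ.toMonoidHom).comp e.toMonoidHom, ?_, ?_⟩
    · show e.symm (φ (e a)) = _
      rw [φa, map_inv, e.symm_apply_apply]
    · show e.symm (φ (e b)) = _
      rw [φb, map_inv, e.symm_apply_apply]
  · exact ⟨e.toMonoidHom.comp (QuotientGroup.mk' _), rfl, rfl⟩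

/-- General presentation for the group of an atomic chiral rotation pair. -/
theorem atomic_group_presentation {G : Type*} [Group G] [Finite G] (a b : G)
    (p q q' : ℕ) (hpq : p < q) (h : IsAtomicPair a b p q) (hq' : q' ∣ q)
    (hcore : (Subgroup.zpowers b).normalCore = Subgroup.zpowers (b ^ q')) :
    Even p ∧ ∃ i k c : ℤ,
      c ^ 2 ≡ 1 [ZMOD ((q / q' : ℕ) : ℤ)] ∧ ¬ (c ≡ 1 [ZMOD ((q / q' : ℕ) : ℤ)]) ∧
      b⁻¹ * a = a ^ i * b ^ (1 + k * (q' : ℤ)) ∧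
      b * a⁻¹ = a ^ (-i) * b ^ (-1 - c * k * (q' : ℤ)) := by
  have hAt := h
  obtain ⟨⟨gen, oa, ob, hp, hq, w, hinf⟩, tight, chir, -, -⟩ := h
  have h : TP_s5 a b := ⟨gen, by rw [← pow_two, w], by
    intro x h1 h2
    have h3 : x ∈ Subgroup.zpowers a ⊓ Subgroup.zpowers b := ⟨h1, h2⟩
    rw [hinf] at h3
    exact h3, tight⟩
  have hN : (Subgroup.zpowers b).normalCore ≠ ⊥ := by
    intro hb
    have h1 : a ∈ Subgroup.zpowers b := by
      apply h.swap.count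
      · rw [Nat.card_zpowers, Nat.card_zpowers, oa, ob]; exact hpq.le
      · intro x hx hx'
        have := h.swap.core_mem hx hx'
        rw [hb] at this
        exact this
    have h2 := h.inf a (Subgroup.mem_zpowers a) h1
    rw [h2, orderOf_one] at oa
    omega
  have hQ : TP_s5 (a : G ⧸ (Subgroup.zpowers b).normalCore)
      (b : G ⧸ (Subgroup.zpowers b).normalCore) := by
    apply h.quot
    intro i j hij
    have h1 := Subgroup.normalCore_le _ hij
    have h2 : a ^ i ∈ Subgroup.zpowers b := by
      have h3 := mul_mem (zpow_mem (Subgroup.mem_zpowers b) j) (inv_mem h1)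
      have h4 : b ^ j * ((a ^ i)⁻¹ * b ^ j)⁻¹ = a ^ i := by group
      rwa [h4] at h3
    rw [h.inf _ (zpow_mem (Subgroup.mem_zpowers a) i) h2]
    exact one_mem _
  have hreg := quot_reg a b p q hAt hN hQ
  have hE := mainE _ _ (a : G ⧸ (Subgroup.zpowers b).normalCore)
      (b : G ⧸ (Subgroup.zpowers b).normalCore) le_rfl hQ hreg
      (quot_core b (Subgroup.zpowers b) (Subgroup.mem_zpowers b))
  obtain ⟨x, hx⟩ := hE
  have hn : (a ^ x)⁻¹ * (b⁻¹ * (a * a) * b) ∈ (Subgroup.zpowers b).normalCore := by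
    rw [← QuotientGroup.eq]
    exact hx
  have hn1 : a⁻¹ * ((a ^ x)⁻¹ * (b⁻¹ * (a * a) * b)) * a ∈ (Subgroup.zpowers b).normalCore := by
    have := (Subgroup.normalCore_normal (Subgroup.zpowers b)).conj_mem _ hn a⁻¹
    rwa [inv_inv] at this
  rw [hcore] at hn1
  obtain ⟨k, hk⟩ := hn1
  have hk : (b ^ q') ^ k = a⁻¹ * ((a ^ x)⁻¹ * (b⁻¹ * (a * a) * b)) * a := hk
  obtain ⟨n0, hn0⟩ : ∃ n0, n0 = b ^ q' := ⟨_, rfl⟩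
  have hn0N : n0 ∈ (Subgroup.zpowers b).normalCore := by
    rw [hcore, hn0]; exact Subgroup.mem_zpowers _
  have hc0 : a⁻¹ * n0 * a ∈ Subgroup.zpowers n0 := by
    have := (Subgroup.normalCore_normal (Subgroup.zpowers b)).conj_mem _ hn0N a⁻¹
    rwa [inv_inv, hcore, ← hn0] at this
  obtain ⟨c, hc⟩ := hc0
  have hc : n0 ^ c = a⁻¹ * n0 * a := hc
  have hbn : Commute b n0 := by rw [hn0]; exact Commute.self_pow b q'
  rw [← hn0] at hk
  have hconj : ∀ m : ℤ, a⁻¹ * n0 ^ m * a = n0 ^ (c * m) := by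
    intro m
    rw [zpow_mul, hc]
    have := conj_zpow (a := a⁻¹) (b := n0) (i := m)
    rw [inv_inv] at this
    exact this.symm
  have hbn' : ∀ m : ℤ, b⁻¹ * n0 ^ m * b = n0 ^ m := by
    intro m
    rw [mul_assoc, ← (hbn.zpow_right m).eq]; group
  have hba : b * a = a⁻¹ * b⁻¹ := by
    rw [← mul_inv_rev, eq_inv_iff_mul_eq_one, h.swap.w]
  have hcc : n0 ^ (c * c) = n0 := by
    have e1 : a * b = b⁻¹ * a⁻¹ := by
      rw [← mul_inv_rev, eq_inv_iff_mul_eq_one, h.w]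
    calc n0 ^ (c * c) = a⁻¹ * n0 ^ c * a := (hconj c).symm
      _ = b * (b⁻¹ * a⁻¹) * n0 ^ c * (a * b) * b⁻¹ := by group
      _ = b * (a * b) * n0 ^ c * (b⁻¹ * a⁻¹) * b⁻¹ := by rw [e1]
      _ = b * (a * (b * n0 ^ c) * b⁻¹ * a⁻¹) * b⁻¹ := by group
      _ = b * (a * (n0 ^ c) * a⁻¹) * b⁻¹ := by rw [(hbn.zpow_right c).eq]; group
      _ = b * n0 * b⁻¹ := by rw [hc]; group
      _ = n0 := by rw [hbn.eq]; group
  have haa : Commute (a * a) n0 := by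
    have e1 : a⁻¹ * (a⁻¹ * n0 * a) * a = n0 := by rw [← hc, hconj, hcc]
    show a * a * n0 = n0 * (a * a)
    calc a * a * n0 = a * a * (a⁻¹ * (a⁻¹ * n0 * a) * a) := by rw [e1]
      _ = _ := by group
  have rel : b⁻¹ * a = a ^ (x + 1) * (b * n0 ^ k) := by
    rw [(hbn.zpow_right k).eq, hk]
    calc b⁻¹ * a = b⁻¹ * (a * a) * (a⁻¹ * b⁻¹) * b := by group
      _ = b⁻¹ * (a * a) * (b * a) * b := by rw [hba]
      _ = _ := by rw [zpow_add, zpow_one]; group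
  have hpow : ∀ m : ℤ, n0 ^ m = b ^ (m * (q' : ℤ)) := by
    intro m
    rw [hn0, mul_comm, zpow_mul, zpow_natCast]
  have hnc : ¬ Commute a n0 := by
    intro h1
    apply chir
    apply Reg.equiv h
    apply central_reg h (x + 1) (k * q')
    · rw [← hpow]; exact h1.zpow_right k
    · rw [← hpow]; exact rel
  have hq0 : q' ≠ 0 := by
    rintro rfl
    have := Nat.eq_zero_of_zero_dvd hq'
    omega
  have on0 : orderOf n0 = q / q' := by
    rw [hn0, orderOf_pow_of_dvd hq0 (by rw [ob]; exact hq'), ob]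
  have hpe : Even p := by
    by_contra ho
    rw [Nat.not_even_iff_odd] at ho
    obtain ⟨m, hm⟩ := ho
    apply hnc
    have h1 : (a * a) ^ (m + 1) = a := by
      rw [← pow_two, ← pow_mul, show 2 * (m + 1) = p + 1 by omega, pow_succ, ← oa,
        pow_orderOf_eq_one, one_mul]
    rw [← h1]
    exact haa.pow_left _
  have hie : ¬ Even (x + 1) := by
    rintro ⟨l, hl⟩
    apply hnc
    have h1 : a ^ (x + 1) = (a * a) ^ l := by
      rw [hl, (Commute.refl a).mul_zpow, zpow_add]
    have h2 : a = b * ((a * a) ^ l * (b * n0 ^ k)) := by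
      rw [← h1, ← rel]; group
    rw [h2]
    exact hbn.mul_left ((haa.zpow_left l).mul_left
      (hbn.mul_left ((Commute.refl n0).zpow_left k)))
  refine ⟨hpe, x + 1, k, c, ?_, ?_, ?_, ?_⟩
  · rw [← on0, ← zpow_eq_zpow_iff_modEq, pow_two, hcc, zpow_one]
  · rw [← on0, ← zpow_eq_zpow_iff_modEq, zpow_one, hc]
    intro h1
    apply hnc
    show a * n0 = n0 * a
    calc a * n0 = a * (a⁻¹ * n0 * a) := by rw [h1]
      _ = _ := by group
  · rw [rel, hpow, zpow_add b, zpow_one]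
  · rw [Int.not_even_iff_odd] at hie
    obtain ⟨l, hl⟩ := hie
    rw [hl]
    rw [hl] at rel
    have e1 : ∀ m : ℤ, a ^ (2 * m) = (a * a) ^ m := by
      intro m
      rw [(Commute.refl a).mul_zpow, two_mul, zpow_add]
    have e2 : a ^ (-(2 * l + 1)) = (a * a) ^ (-l - 1) * a := by
      rw [← e1, ← zpow_add_one]; congr 1; ring
    have e3 : b ^ (-1 - c * k * (q' : ℤ)) = n0 ^ (c * -k) * b⁻¹ := by
      rw [hpow, ← zpow_sub_one]; congr 1; ring
    have e4 : n0 ^ (-k) * a ^ (-(2 * l + 1)) = a ^ (-(2 * l + 1)) * n0 ^ (c * -k) := by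
      rw [e2, ← hconj (-k), ← mul_assoc, ← ((haa.zpow_left (-l - 1)).zpow_right (-k)).eq]
      group
    calc b * a⁻¹ = b * (b⁻¹ * a)⁻¹ * b⁻¹ := by group
      _ = b * (a ^ (2 * l + 1) * (n0 ^ k * b))⁻¹ * b⁻¹ := by
        rw [rel, (hbn.zpow_right k).eq]
      _ = n0 ^ (-k) * a ^ (-(2 * l + 1)) * b⁻¹ := by
        rw [mul_inv_rev, mul_inv_rev, zpow_neg, zpow_neg]; simp only [mul_assoc, mul_inv_cancel_left]
      _ = _ := by rw [e4, e3, mul_assoc]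
end
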